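/- There exist constants c > 0 and d₀ such that for all integers d ≥ d₀, | |F_5| − (2e − 4√e + 2)·2^{2^{d−1}} | ≤ e^{−cd}·2^{2^{d−1}}. -/

import Mathlib

/-- Two vertices of the Hamming cube `{0,1}^d` are adjacent iff they differ in
exactly one coordinate. -/
def cubeAdj (d : ℕ) (u v : Fin d → Bool) : Prop :=
  (Finset.univ.filter fun i => u i ≠ v i).card = 1


/-- The set of homomorphisms from `Q_d` to `ℤ` sending the all-zeros vertex to `0`. -/
def HomF (d : ℕ) : Set ((Fin d → Bool) → ℤ) :=
  {f | f (fun _ => false) = 0 ∧ ∀ u v, cubeAdj d u v → |f u - f v| = 1}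

/-- Those homomorphisms whose range (image) has exactly `i` elements. -/
def HomFi (d i : ℕ) : Set ((Fin d → Bool) → ℤ) :=
  {f ∈ HomF d | (Set.range f).ncard = i}

namespace CubeCount

open Finset

set_option linter.unusedSectionVars false

/-! ### Counting tools -/

/-- Few subsets of a finite set have small cardinality. -/
lemma card_small_subsets_le {γ : Type*} [DecidableEq γ] (P : Finset γ) (m B : ℝ) (hB : 1 ≤ B) :
    (#(P.powerset.filter fun V => (#V : ℝ) ≤ m) : ℝ) ≤
      Real.exp (m * Real.log B + #P / B) := by
  have hB0 : 0 < B := by linarith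
  have h1 : ∑ V ∈ P.powerset, (1 / B) ^ #V = (1 / B + 1) ^ #P := by
    have := Finset.sum_pow_mul_eq_add_pow (1 / B) (1 : ℝ) P
    simpa using this
  have h2 : (1 / B + 1) ^ #P ≤ Real.exp (#P / B) := by
    have : 1 / B + 1 ≤ Real.exp (1 / B) := Real.add_one_le_exp _
    calc (1 / B + 1) ^ #P ≤ Real.exp (1 / B) ^ #P := by gcongr
      _ = Real.exp (#P / B) := by rw [← Real.exp_nat_mul]; congr 1; ring
  have h3 : ∑ V ∈ P.powerset.filter (fun V => (#V : ℝ) ≤ m), Real.exp (-(m * Real.log B)) ≤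
      ∑ V ∈ P.powerset, (1 / B) ^ #V := by
    calc _ ≤ ∑ V ∈ P.powerset.filter (fun V => (#V : ℝ) ≤ m), (1 / B) ^ #V := by
          apply Finset.sum_le_sum
          intro V hV
          have hV := (Finset.mem_filter.1 hV).2
          have : (1 / B) ^ #V = Real.exp (-(#V * Real.log B)) := by
            rw [Real.exp_neg, ← Real.log_pow, Real.exp_log (by positivity)]; simp
          rw [this]
          have := mul_le_mul_of_nonneg_right hV (Real.log_nonneg hB)
          exact Real.exp_le_exp.2 (by linarith)
      _ ≤ _ := Finset.sum_le_sum_of_subset_of_nonneg (Finset.filter_subset _ _)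
          (fun _ _ _ => by positivity)
  rw [Finset.sum_const, nsmul_eq_mul] at h3
  have h4 := h3.trans (h1.le.trans h2)
  rw [Real.exp_add]
  have h5 : Real.exp (m * Real.log B) * Real.exp (-(m * Real.log B)) = 1 := by
    rw [← Real.exp_add]; simp
  calc _ = Real.exp (m * Real.log B) *
        (#(P.powerset.filter fun V => (#V : ℝ) ≤ m) * Real.exp (-(m * Real.log B))) := by
        rw [mul_left_comm, h5, mul_one]
    _ ≤ _ := by gcongr

/-- Every nonempty part of `U` meets `P` or is joined to the rest of `U`. -/
def Reach {γ : Type*} [DecidableEq γ] (nb : γ → Finset γ) (P U : Finset γ) : Prop :=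
  ∀ W ⊆ U, W.Nonempty → (∃ w ∈ W, w ∈ P) ∨ ∃ w ∈ W, ∃ u ∈ U \ W, w ∈ nb u

open Classical in
lemma sum_reach_le {γ : Type*} [Fintype γ] [DecidableEq γ] (nb : γ → Finset γ) (D : ℕ)
    (hD : ∀ c, #(nb c) ≤ D) (x y : ℝ) (hx : 0 ≤ x) (hy : 0 ≤ y) (hxy : x * (1 + y) ^ D ≤ y)
    (P : Finset γ) :
    ∑ U ∈ univ.filter (Reach nb P), x ^ #U ≤ (1 + y) ^ #P := by
  have key : ∀ m : ℕ, ∀ P : Finset γ,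
      ∑ U ∈ univ.filter (fun U => Reach nb P U ∧ #U ≤ m), x ^ #U ≤ (1 + y) ^ #P := by
    intro m
    induction m with
    | zero =>
      intro P
      have : univ.filter (fun U => Reach nb P U ∧ #U ≤ 0) ⊆ {∅} := by
        intro U; simp
      calc _ ≤ ∑ U ∈ ({∅} : Finset (Finset γ)), x ^ #U :=
            Finset.sum_le_sum_of_subset_of_nonneg this (fun _ _ _ => by positivity)
        _ = 1 := by simp
        _ ≤ _ := one_le_pow₀ (by linarith)
    | succ m ih =>
      intro P
      have hmap : ∀ U ∈ univ.filter (fun U => Reach nb P U ∧ #U ≤ m + 1),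
          (⟨U ∩ P, U \ P⟩ : (_ : Finset γ) × Finset γ) ∈ P.powerset.sigma (fun J =>
            univ.filter (fun U => Reach nb (J.biUnion nb) U ∧ #U ≤ m)) := by
        intro U hU
        simp only [mem_filter, mem_univ, true_and] at hU
        obtain ⟨hR, hc⟩ := hU
        simp only [mem_sigma, mem_powerset, mem_filter, mem_univ, true_and]
        refine ⟨inter_subset_right, ?_, ?_⟩
        · intro W hW hne
          rcases hR W (hW.trans sdiff_subset) hne with ⟨w, hw, hwP⟩ | ⟨w, hw, u, hu, hwu⟩
          · exact absurd hwP (Finset.mem_sdiff.1 (hW hw)).2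
          · by_cases huP : u ∈ P
            · left
              exact ⟨w, hw, mem_biUnion.2
                ⟨u, mem_inter.2 ⟨(mem_sdiff.1 hu).1, huP⟩, hwu⟩⟩
            · right
              exact ⟨w, hw, u, by simp_all, hwu⟩
        · rcases U.eq_empty_or_nonempty with rfl | hne
          · simp
          · have : (U ∩ P).Nonempty := by
              rcases hR U (Subset.refl _) hne with ⟨w, hw, hwP⟩ | ⟨w, hw, u, hu, hwu⟩
              · exact ⟨w, mem_inter.2 ⟨hw, hwP⟩⟩
              · simp at hu
            have h1 := card_inter_add_card_sdiff U P
            have := this.card_pos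
            omega
      calc ∑ U ∈ univ.filter (fun U => Reach nb P U ∧ #U ≤ m + 1), x ^ #U
          = ∑ U ∈ univ.filter (fun U => Reach nb P U ∧ #U ≤ m + 1),
              x ^ #(U ∩ P) * x ^ #(U \ P) := by
            apply Finset.sum_congr rfl
            intro U _
            rw [← pow_add, card_inter_add_card_sdiff]
        _ ≤ ∑ p ∈ P.powerset.sigma (fun J =>
              univ.filter (fun U => Reach nb (J.biUnion nb) U ∧ #U ≤ m)),
              x ^ #p.1 * x ^ #p.2 := by
            rw [← Finset.sum_image (f := fun p : (_ : Finset γ) × Finset γ =>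
              x ^ #p.1 * x ^ #p.2) (g := fun U => ⟨U ∩ P, U \ P⟩)]
            · apply Finset.sum_le_sum_of_subset_of_nonneg
              · intro p hp
                obtain ⟨U, hU, rfl⟩ := mem_image.1 hp
                exact hmap U hU
              · intros; positivity
            · intro U _ V _ h
              simp only [Sigma.mk.injEq, heq_eq_eq] at h
              rw [← sdiff_union_inter U P, ← sdiff_union_inter V P, h.1, h.2]
        _ = ∑ J ∈ P.powerset, x ^ #J * ∑ U ∈ univ.filter
              (fun U => Reach nb (J.biUnion nb) U ∧ #U ≤ m), x ^ #U := by
            rw [Finset.sum_sigma]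
            simp only [Finset.mul_sum]
        _ ≤ ∑ J ∈ P.powerset, (x * (1 + y) ^ D) ^ #J := by
            apply Finset.sum_le_sum
            intro J _
            rw [mul_pow, ← pow_mul]
            apply mul_le_mul_of_nonneg_left _ (by positivity)
            refine (ih _).trans ?_
            apply pow_le_pow_right₀ (by linarith)
            rw [mul_comm]
            exact card_biUnion_le_card_mul _ _ _ (fun c _ => hD c)
        _ ≤ ∑ J ∈ P.powerset, y ^ #J := by
            apply Finset.sum_le_sum
            intro J _
            gcongr
        _ = (1 + y) ^ #P := by
            have := Finset.sum_pow_mul_eq_add_pow y (1 : ℝ) P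
            rw [add_comm]
            simpa using this
  have := key (Fintype.card γ) P
  convert this using 4
  exact ⟨fun h => ⟨h, card_le_univ _⟩, fun h => h.1⟩

open Classical in
/-- Rooted connected sets are few. -/
lemma sum_reach_le_exp {γ : Type*} [Fintype γ] [DecidableEq γ] (nb : γ → Finset γ) (D : ℕ)
    (hD0 : 0 < D) (hD : ∀ c, #(nb c) ≤ D) (P : Finset γ) :
    ∑ U ∈ univ.filter (Reach nb P), (1 / (3 * D : ℝ)) ^ #U ≤ Real.exp (#P / D) := by
  have hD' : (0 : ℝ) < D := by exact_mod_cast hD0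
  have h1 : (1 + 1 / (D : ℝ)) ≤ Real.exp (1 / D) := by
    rw [add_comm]; exact Real.add_one_le_exp _
  refine (sum_reach_le nb D hD (1 / (3 * D)) (1 / D) (by positivity) (by positivity) ?_ P).trans ?_
  · have : (1 + 1 / (D : ℝ)) ^ D ≤ 3 := by
      calc (1 + 1 / (D : ℝ)) ^ D ≤ Real.exp (1 / D) ^ D := by gcongr
        _ = Real.exp 1 := by rw [← Real.exp_nat_mul]; congr 1; field_simp
        _ ≤ 3 := by linarith [Real.exp_one_lt_d9]
    calc 1 / (3 * D : ℝ) * (1 + 1 / (D : ℝ)) ^ D ≤ 1 / (3 * D : ℝ) * 3 := by gcongr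
      _ = 1 / D := by field_simp
  · calc (1 + 1 / (D : ℝ)) ^ #P ≤ Real.exp (1 / D) ^ #P := by gcongr
      _ = Real.exp (#P / D) := by rw [← Real.exp_nat_mul]; congr 1; ring

open Classical in
lemma card_reach_le {γ : Type*} [Fintype γ] [DecidableEq γ] (nb : γ → Finset γ) (D : ℕ)
    (hD0 : 0 < D) (hD : ∀ c, #(nb c) ≤ D) (P : Finset γ) (m : ℝ) :
    (#(univ.filter fun U => Reach nb P U ∧ (#U : ℝ) ≤ m) : ℝ) ≤
      Real.exp (m * Real.log (3 * D) + #P / D) := by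
  have hD' : (1 : ℝ) ≤ D := by exact_mod_cast hD0
  have h3 : ∑ U ∈ univ.filter (fun U => Reach nb P U ∧ (#U : ℝ) ≤ m),
      Real.exp (-(m * Real.log (3 * D))) ≤ Real.exp (#P / D) := by
    calc _ ≤ ∑ U ∈ univ.filter (fun U => Reach nb P U ∧ (#U : ℝ) ≤ m),
          (1 / (3 * D : ℝ)) ^ #U := by
          apply Finset.sum_le_sum
          intro V hV
          have hV := (Finset.mem_filter.1 hV).2.2
          have : (1 / (3 * D : ℝ)) ^ #V = Real.exp (-(#V * Real.log (3 * D))) := by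
            rw [Real.exp_neg, ← Real.log_pow, Real.exp_log (by positivity), one_div, inv_pow]
          rw [this]
          have := mul_le_mul_of_nonneg_right hV (Real.log_nonneg (x := 3 * D) (by linarith))
          exact Real.exp_le_exp.2 (by linarith)
      _ ≤ ∑ U ∈ univ.filter (Reach nb P), (1 / (3 * D : ℝ)) ^ #U := by
          apply Finset.sum_le_sum_of_subset_of_nonneg
          · intro U; simp +contextual
          · intros; positivity
      _ ≤ _ := sum_reach_le_exp nb D hD0 hD P
  rw [Finset.sum_const, nsmul_eq_mul] at h3
  rw [Real.exp_add]
  have h5 : Real.exp (m * Real.log (3 * D)) * Real.exp (-(m * Real.log (3 * D))) = 1 := by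
    rw [← Real.exp_add]; simp
  calc _ = Real.exp (m * Real.log (3 * D)) *
        (#(univ.filter fun U => Reach nb P U ∧ (#U : ℝ) ≤ m) *
          Real.exp (-(m * Real.log (3 * D)))) := by
        rw [mul_left_comm, h5, mul_one]
    _ ≤ _ := by gcongr

/-- A greedily chosen subfamily after which no member adds more than `ψ` new points. -/
lemma exists_greedy {γ δ : Type*} [DecidableEq γ] [DecidableEq δ] (N : γ → Finset δ)
    (X : Finset γ) (F : Finset δ) (ψ : ℕ) :
    ∃ U ⊆ X, (ψ + 1) * #U ≤ #(U.biUnion N \ F) ∧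
      ∀ u ∈ X, #(N u \ (F ∪ U.biUnion N)) ≤ ψ := by
  obtain ⟨U, hU, hmax⟩ := Finset.exists_max_image
    (X.powerset.filter fun U => (ψ + 1) * #U ≤ #(U.biUnion N \ F)) card ⟨∅, by simp⟩
  simp only [mem_filter, mem_powerset] at hU hmax
  refine ⟨U, hU.1, hU.2, fun u hu => ?_⟩
  by_contra! hlt
  have huU : u ∉ U := by
    intro h
    have : N u \ (F ∪ U.biUnion N) = ∅ := by
      rw [sdiff_eq_empty_iff_subset]
      exact (subset_biUnion_of_mem N h).trans subset_union_right
    rw [this] at hlt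
    simp at hlt
  have h := hmax (insert u U) ⟨insert_subset hu hU.1, ?_⟩
  · rw [card_insert_of_notMem huU] at h
    omega
  · rw [card_insert_of_notMem huU, biUnion_insert]
    have h1 : (N u ∪ U.biUnion N) \ F = (N u \ (F ∪ U.biUnion N)) ∪ (U.biUnion N \ F) := by
      ext b
      simp only [mem_sdiff, mem_union]
      tauto
    have h2 : Disjoint (N u \ (F ∪ U.biUnion N)) (U.biUnion N \ F) := by
      rw [Finset.disjoint_left]
      intro b hb hb'
      simp only [mem_sdiff, mem_union] at hb hb'
      tauto
    rw [h1, card_union_of_disjoint h2]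
    nlinarith [hU.2]

/-! ### Regular bipartite graphs with the expansion of the cube -/

/-- A `d`-regular bipartite graph with parts `α`, `β` of size `2 ^ (d - 1)`, given by its two
neighbourhood maps, with small codegrees and cube-like vertex expansion. -/
structure CubeLike {α β : Type*} [Fintype α] [Fintype β] [DecidableEq α] [DecidableEq β]
    (d : ℕ) (N : α → Finset β) (M : β → Finset α) : Prop where
  mem_iff : ∀ a b, b ∈ N a ↔ a ∈ M b
  deg : ∀ a, #(N a) = d
  deg' : ∀ b, #(M b) = d
  codeg : ∀ a a', a ≠ a' → #(N a ∩ N a') ≤ 2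
  codeg' : ∀ b b', b ≠ b' → #(M b ∩ M b') ≤ 2
  iso : ∀ T : Finset α, 2 * #T ≤ Fintype.card α →
    (#T : ℝ) ≤ 2 * √d * ((#(T.biUnion N) : ℝ) - #T)
  iso' : ∀ T : Finset β, 2 * #T ≤ Fintype.card β →
    (#T : ℝ) ≤ 2 * √d * ((#(T.biUnion M) : ℝ) - #T)
  card_left : Fintype.card α = 2 ^ (d - 1)
  card_right : Fintype.card β = 2 ^ (d - 1)

section
variable {α β : Type*} [Fintype α] [Fintype β] [DecidableEq α] [DecidableEq β]
  {d : ℕ} {N : α → Finset β} {M : β → Finset α}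

lemma CubeLike.symm (h : CubeLike d N M) : CubeLike d M N :=
  ⟨fun b a => (h.mem_iff a b).symm, h.deg', h.deg, h.codeg', h.codeg, h.iso', h.iso,
    h.card_right, h.card_left⟩

/-- The vertices all of whose neighbours lie in `F`. -/
def interior (N : α → Finset β) (F : Finset β) : Finset α := univ.filter fun a => N a ⊆ F

/-- The largest set with the same neighbourhood as `T`. -/
def cl (N : α → Finset β) (T : Finset α) : Finset α := interior N (T.biUnion N)

lemma mem_cl {T : Finset α} {a : α} : a ∈ cl N T ↔ N a ⊆ T.biUnion N := by
  simp [cl, interior]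

lemma subset_cl (T : Finset α) : T ⊆ cl N T := fun _ ha =>
  mem_cl.2 (subset_biUnion_of_mem N ha)

lemma biUnion_cl (T : Finset α) : (cl N T).biUnion N = T.biUnion N := by
  apply subset_antisymm
  · exact biUnion_subset.2 fun a ha => mem_cl.1 ha
  · exact biUnion_subset_biUnion_of_subset_left N (subset_cl T)

/-- Two vertices are linked if they share a neighbour; `K` is linked if it is connected. -/
def Linked (N : α → Finset β) (K : Finset α) : Prop :=
  ∀ W ⊆ K, W.Nonempty → W ≠ K → ∃ w ∈ W, ∃ u ∈ K \ W, (N w ∩ N u).Nonempty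

lemma CubeLike.sum_inter (h : CubeLike d N M) (S : Finset α) (F : Finset β) :
    ∑ a ∈ S, #(N a ∩ F) = ∑ b ∈ F, #(M b ∩ S) := by
  have h1 : ∀ a, #(N a ∩ F) = ∑ b ∈ F, if b ∈ N a then 1 else 0 := by
    intro a
    rw [Finset.sum_boole, inter_comm, ← filter_mem_eq_inter]; simp
  have h2 : ∀ b, #(M b ∩ S) = ∑ a ∈ S, if a ∈ M b then 1 else 0 := by
    intro b
    rw [Finset.sum_boole, inter_comm, ← filter_mem_eq_inter]; simp
  simp_rw [h1, h2]
  rw [Finset.sum_comm]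
  simp_rw [h.mem_iff]

/-- Neighbours of neighbours. -/
def nbr2 (N : α → Finset β) (M : β → Finset α) (a : α) : Finset α := (N a).biUnion M

lemma CubeLike.mem_nbr2 (h : CubeLike d N M) {a u : α} :
    u ∈ nbr2 N M a ↔ (N a ∩ N u).Nonempty := by
  simp only [nbr2, mem_biUnion, Finset.Nonempty, mem_inter, ← h.mem_iff]

lemma CubeLike.card_biUnion_le (h : CubeLike d N M) (S : Finset α) :
    #(S.biUnion N) ≤ d * #S := by
  rw [mul_comm]
  exact card_biUnion_le_card_mul _ _ _ fun a _ => (h.deg a).le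

lemma CubeLike.card_nbr2_le (h : CubeLike d N M) (a : α) : #(nbr2 N M a) ≤ d ^ 2 := by
  rw [sq]
  nth_rw 1 [← h.deg a]
  exact card_biUnion_le_card_mul _ _ _ fun a _ => (h.deg' a).le

/-- Vertices at most three link steps away. -/
def nbr6 (N : α → Finset β) (M : β → Finset α) (a : α) : Finset α :=
  ((nbr2 N M a).biUnion (nbr2 N M)).biUnion (nbr2 N M)

lemma CubeLike.card_nbr6_le (h : CubeLike d N M) (a : α) : #(nbr6 N M a) ≤ d ^ 6 := by
  have h1 : #((nbr2 N M a).biUnion (nbr2 N M)) ≤ d ^ 4 :=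
    calc _ ≤ #(nbr2 N M a) * d ^ 2 :=
          card_biUnion_le_card_mul _ _ _ fun a _ => h.card_nbr2_le a
      _ ≤ d ^ 2 * d ^ 2 := by gcongr; exact h.card_nbr2_le a
      _ = d ^ 4 := by ring
  calc _ ≤ #((nbr2 N M a).biUnion (nbr2 N M)) * d ^ 2 :=
        card_biUnion_le_card_mul _ _ _ fun a _ => h.card_nbr2_le a
    _ ≤ d ^ 4 * d ^ 2 := by gcongr
    _ = d ^ 6 := by ring

/-- The edges leaving the neighbourhood of a closed set. -/
lemma CubeLike.sum_out (h : CubeLike d N M) {K : Finset α} {t : ℕ}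
    (ht : #(K.biUnion N) = #(cl N K) + t) :
    ∑ b ∈ K.biUnion N, #(M b \ cl N K) = d * t := by
  have h1 : ∑ b ∈ K.biUnion N, #(M b ∩ cl N K) = d * #(cl N K) := by
    rw [← h.sum_inter]
    rw [Finset.sum_congr rfl (g := fun _ => d), sum_const, smul_eq_mul, mul_comm]
    intro a ha
    rw [inter_eq_left.2 (mem_cl.1 ha), h.deg]
  have h2 : ∑ b ∈ K.biUnion N, (#(M b \ cl N K) + #(M b ∩ cl N K)) = d * #(K.biUnion N) := by
    rw [Finset.sum_congr rfl (g := fun _ => d), sum_const, smul_eq_mul, mul_comm]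
    intro b _
    rw [card_sdiff_add_card_inter, h.deg']
  rw [sum_add_distrib, h1, ht] at h2
  linarith

lemma CubeLike.sum_out' (h : CubeLike d N M) {K : Finset α} {t : ℕ}
    (ht : #(K.biUnion N) = #(cl N K) + t) (S : Finset α) :
    ∑ a ∈ S \ cl N K, #(N a ∩ K.biUnion N) ≤ d * t := by
  rw [← h.sum_out ht, h.sum_inter]
  apply Finset.sum_le_sum
  intro b _
  apply card_le_card
  intro a
  simp only [mem_inter, mem_sdiff]
  tauto

/-- A first coarse approximation of the neighbourhood of a linked set. -/
lemma CubeLike.coarse (h : CubeLike d N M) (hd : 2 ≤ d) (v : α) (a t : ℕ) :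
    ∃ 𝒰 : Finset (Finset α),
      (#𝒰 : ℝ) ≤ Real.exp (2 * (a + t) / d * Real.log (3 * d ^ 6) + 1) ∧
      ∀ K : Finset α, v ∈ K → Linked N K → #(cl N K) = a → #(K.biUnion N) = a + t →
        ∃ U ∈ 𝒰, U.biUnion N ⊆ K.biUnion N ∧
          ∀ u ∈ cl N K, d ≤ 2 * #(N u ∩ U.biUnion N) := by
  classical
  have hd0 : (0 : ℝ) < d := by exact_mod_cast (by omega : 0 < d)
  refine ⟨univ.filter fun U => Reach (nbr6 N M) (nbr2 N M v) U ∧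
    (#U : ℝ) ≤ 2 * (a + t) / d, ?_, ?_⟩
  · refine (card_reach_le (nbr6 N M) (d ^ 6) (by positivity) h.card_nbr6_le _ _).trans ?_
    apply Real.exp_le_exp.2
    push_cast
    gcongr
    rw [div_le_one (by positivity)]
    calc (#(nbr2 N M v) : ℝ) ≤ d ^ 2 := by exact_mod_cast h.card_nbr2_le v
      _ ≤ d ^ 6 := by
        apply pow_le_pow_right₀ _ (by norm_num)
        exact_mod_cast (by omega : 1 ≤ d)
  · intro K hv hK ha hg
    obtain ⟨U, hU, hUc, hUg⟩ := exists_greedy N (cl N K) ∅ (d / 2)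
    simp only [sdiff_empty, empty_union] at hUc hUg
    have hUK : U.biUnion N ⊆ K.biUnion N := by
      rw [← biUnion_cl K]; exact biUnion_subset_biUnion_of_subset_left N hU
    have hnear : ∀ u ∈ cl N K, d ≤ 2 * #(N u ∩ U.biUnion N) := by
      intro u hu
      have h1 := hUg u hu
      have h2 := card_sdiff_add_card_inter (N u) (U.biUnion N)
      rw [h.deg] at h2
      omega
    refine ⟨U, ?_, hUK, hnear⟩
    simp only [mem_filter, mem_univ, true_and]
    constructor
    · have hlink : ∀ u ∈ cl N K, ∃ x ∈ U, (N u ∩ N x).Nonempty := by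
        intro u hu
        have : (N u ∩ U.biUnion N).Nonempty := by
          rw [← card_pos]; have := hnear u hu; omega
        obtain ⟨b, hb⟩ := this
        obtain ⟨hb1, hb2⟩ := mem_inter.1 hb
        obtain ⟨x, hx, hbx⟩ := mem_biUnion.1 hb2
        exact ⟨x, hx, b, mem_inter.2 ⟨hb1, hbx⟩⟩
      intro W hW hne
      set TW := K.filter fun τ => ∃ w ∈ W, (N τ ∩ N w).Nonempty with hTW
      by_cases hvW : v ∈ TW
      · left
        obtain ⟨_, w, hw, hvw⟩ := mem_filter.1 hvW
        exact ⟨w, hw, h.mem_nbr2.2 hvw⟩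
      · right
        have hTne : TW.Nonempty := by
          obtain ⟨w, hw⟩ := hne
          have hwc := mem_cl.1 (hU (hW hw))
          have : (N w).Nonempty := by rw [← card_pos, h.deg]; omega
          obtain ⟨b, hb⟩ := this
          obtain ⟨τ, hτ, hbτ⟩ := mem_biUnion.1 (hwc hb)
          exact ⟨τ, mem_filter.2 ⟨hτ, w, hw, b, mem_inter.2 ⟨hbτ, hb⟩⟩⟩
        obtain ⟨τ, hτ, τ', hτ', hττ⟩ := hK TW (filter_subset _ _) hTne
          (fun he => hvW (he ▸ hv))
        obtain ⟨hτK, w, hw, hτw⟩ := mem_filter.1 hτ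
        obtain ⟨hτ'K, hτ'W⟩ := mem_sdiff.1 hτ'
        obtain ⟨u, hu, hτ'u⟩ := hlink τ' (subset_cl K hτ'K)
        refine ⟨w, hw, u, mem_sdiff.2 ⟨hu, fun huW => hτ'W (mem_filter.2
          ⟨hτ'K, u, huW, hτ'u⟩)⟩, ?_⟩
        simp only [nbr6, mem_biUnion, h.mem_nbr2]
        refine ⟨τ, ⟨τ', ?_, ?_⟩, hτw⟩
        · rwa [inter_comm]
        · rwa [inter_comm]
    · rw [le_div_iff₀ hd0]
      have h1 : d * #U ≤ 2 * (a + t) := by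
        have h2 := card_le_card hUK
        rw [hg] at h2
        have h3 : d ≤ 2 * (d / 2 + 1) := by omega
        calc d * #U ≤ 2 * (d / 2 + 1) * #U := by gcongr
          _ = 2 * ((d / 2 + 1) * #U) := by ring
          _ ≤ 2 * (a + t) := by omega
      rw [mul_comm]; exact_mod_cast h1

end

section
variable {α β : Type*} [Fintype α] [Fintype β] [DecidableEq α] [DecidableEq β]
  {d : ℕ} {N : α → Finset β} {M : β → Finset α}

lemma CubeLike.card_core_le (h : CubeLike d N M) (F : Finset β) :
    d * #(univ.filter fun a => d ≤ 2 * #(N a ∩ F)) ≤ d * (2 * #F) := by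
  set S := univ.filter fun a => d ≤ 2 * #(N a ∩ F) with hS
  calc d * #S = ∑ a ∈ S, d := by rw [sum_const, smul_eq_mul, mul_comm]
    _ ≤ ∑ a ∈ S, 2 * #(N a ∩ F) := Finset.sum_le_sum fun a ha => (mem_filter.1 ha).2
    _ = 2 * ∑ b ∈ F, #(M b ∩ S) := by rw [← mul_sum, h.sum_inter]
    _ ≤ 2 * ∑ b ∈ F, d := by
      gcongr with b _
      rw [← h.deg' b]; exact card_le_card inter_subset_left
    _ = d * (2 * #F) := by rw [sum_const, smul_eq_mul]; ring

lemma CubeLike.card_core_sdiff_le (h : CubeLike d N M) {K : Finset α} {F : Finset β} {t : ℕ}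
    (hF : F ⊆ K.biUnion N) (ht : #(K.biUnion N) = #(cl N K) + t) :
    d * #((univ.filter fun a => d ≤ 2 * #(N a ∩ F)) \ cl N K) ≤ d * (2 * t) := by
  set S := univ.filter fun a => d ≤ 2 * #(N a ∩ F) with hS
  calc d * #(S \ cl N K) = ∑ a ∈ S \ cl N K, d := by rw [sum_const, smul_eq_mul, mul_comm]
    _ ≤ ∑ a ∈ S \ cl N K, 2 * #(N a ∩ K.biUnion N) := by
      apply Finset.sum_le_sum
      intro a ha
      refine (mem_filter.1 (mem_sdiff.1 ha).1).2.trans ?_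
      gcongr
    _ ≤ 2 * (d * t) := by rw [← mul_sum]; gcongr; exact h.sum_out' ht S
    _ = d * (2 * t) := by ring

/-- Refining a coarse approximation. -/
lemma CubeLike.refine (h : CubeLike d N M) (hd : 4 ≤ d) (a t : ℕ) (F₁ : Finset β)
    (S₁ : Finset α) (hS₁ : #S₁ ≤ 2 * (a + t)) :
    ∃ 𝒜 : Finset (Finset β × Finset α),
      (#𝒜 : ℝ) ≤
        Real.exp (2 * (2 * t / √d * Real.log (d ^ 3) + 2 * (a + t) / (d : ℝ) ^ 2)) ∧
      ∀ K : Finset α, #(cl N K) = a → #(K.biUnion N) = a + t → F₁ ⊆ K.biUnion N →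
        cl N K ⊆ S₁ → #(S₁ \ cl N K) ≤ 2 * t →
        ∃ p ∈ 𝒜, p.1 ⊆ K.biUnion N ∧ cl N K ⊆ p.2 ∧ p.2 ⊆ S₁ ∧
          d * #p.2 ≤ d * #p.1 + 4 * Nat.sqrt d * t := by
  classical
  have hd0 : (0 : ℝ) < d := by exact_mod_cast (by omega : 0 < d)
  have hd1 : (1 : ℝ) ≤ d := by exact_mod_cast (by omega : 1 ≤ d)
  set ψ := Nat.sqrt d with hψ
  have hψd : 2 * ψ ≤ d := by
    have h1 : ψ * ψ ≤ d := Nat.sqrt_le d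
    have h2 : 2 ≤ ψ := by rw [hψ, Nat.le_sqrt]; omega
    nlinarith
  have hψs : √(d : ℝ) ≤ ψ + 1 := by
    rw [Real.sqrt_le_left (by positivity)]
    have h3 : d < (ψ + 1) * (ψ + 1) := Nat.lt_succ_sqrt d
    have : (d : ℝ) ≤ ((ψ + 1) * (ψ + 1) : ℕ) := by exact_mod_cast h3.le
    push_cast at this
    nlinarith
  set m : ℝ := 2 * t / √d with hm
  have hmle : ∀ k : ℕ, (ψ + 1) * k ≤ 2 * t → (k : ℝ) ≤ m := by
    intro k hk
    rw [hm, le_div_iff₀ (by positivity)]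
    have : ((ψ : ℝ) + 1) * k ≤ 2 * t := by exact_mod_cast hk
    nlinarith [(Nat.cast_nonneg k : (0 : ℝ) ≤ k)]
  let S₂ : Finset β → Finset α := fun V => S₁ \ V.biUnion M
  let F₂ : Finset β → Finset β := fun V =>
    F₁ ∪ univ.filter fun b => ψ < #(M b ∩ S₂ V)
  let F₃ : Finset β → Finset α → Finset β := fun V U => F₂ V ∪ U.biUnion N
  let S₃ : Finset β → Finset α → Finset α := fun V U =>
    (S₂ V).filter fun a => #(N a \ F₃ V U) ≤ ψ
  let 𝒱 := (S₁.biUnion N).powerset.filter fun V => (#V : ℝ) ≤ m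
  let 𝒲 := S₁.powerset.filter fun U => (#U : ℝ) ≤ m
  refine ⟨(𝒱 ×ˢ 𝒲).image fun q => (F₃ q.1 q.2, S₃ q.1 q.2), ?_, ?_⟩
  · have hc : (#((𝒱 ×ˢ 𝒲).image fun q => (F₃ q.1 q.2, S₃ q.1 q.2)) : ℝ) ≤ #𝒱 * #𝒲 := by
      rw [← Nat.cast_mul, ← card_product]
      exact_mod_cast card_image_le
    refine hc.trans ?_
    have hd3 : (1 : ℝ) ≤ d ^ 3 := one_le_pow₀ hd1
    rw [two_mul (2 * (t : ℝ) / √d * _ + _), Real.exp_add]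
    have hS₁' : (#S₁ : ℝ) ≤ 2 * (a + t) := by exact_mod_cast hS₁
    gcongr
    · refine (card_small_subsets_le (S₁.biUnion N) m (d ^ 3) hd3).trans ?_
      apply Real.exp_le_exp.2
      have h1 : (#(S₁.biUnion N) : ℝ) ≤ d * #S₁ := by exact_mod_cast h.card_biUnion_le S₁
      have h2 : (#(S₁.biUnion N) : ℝ) / d ^ 3 ≤ 2 * (a + t) / (d : ℝ) ^ 2 := by
        rw [div_le_div_iff₀ (by positivity) (by positivity)]
        calc (#(S₁.biUnion N) : ℝ) * d ^ 2 ≤ (d * (2 * (a + t))) * d ^ 2 := by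
              gcongr; exact h1.trans (by gcongr)
          _ = _ := by ring
      linarith
    · refine (card_small_subsets_le S₁ m (d ^ 3) hd3).trans ?_
      apply Real.exp_le_exp.2
      have h2 : (#S₁ : ℝ) / d ^ 3 ≤ 2 * (a + t) / (d : ℝ) ^ 2 := by
        gcongr
        norm_num
      linarith
  · intro K ha hg hF hS hSout
    set G := K.biUnion N with hG
    set A := cl N K with hA
    have hg' : #(K.biUnion N) = #(cl N K) + t := by rw [← hG, ← hA, ha, hg]
    obtain ⟨V, hVX, hVc, hVg⟩ := exists_greedy M (S₁.biUnion N \ G) S₁ᶜ ψ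
    have hVA : Disjoint A (V.biUnion M) := by
      rw [Finset.disjoint_left]
      intro u hu hu'
      obtain ⟨b, hb, hub⟩ := mem_biUnion.1 hu'
      exact (mem_sdiff.1 (hVX hb)).2 (mem_cl.1 hu ((h.mem_iff u b).2 hub))
    have hVm : (ψ + 1) * #V ≤ 2 * t := by
      refine hVc.trans (le_trans (card_le_card ?_) hSout)
      intro u hu
      simp only [mem_sdiff, mem_compl, not_not] at hu ⊢
      exact ⟨hu.2, fun hc => Finset.disjoint_left.1 hVA hc hu.1⟩
    have hAS₂ : A ⊆ S₂ V := fun u hu => mem_sdiff.2 ⟨hS hu, Finset.disjoint_left.1 hVA hu⟩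
    have hF₂ : F₂ V ⊆ G := by
      apply union_subset hF
      intro b hb
      have hb := (mem_filter.1 hb).2
      by_contra hbG
      have hbN : b ∈ S₁.biUnion N := by
        have : (M b ∩ S₂ V).Nonempty := by rw [← card_pos]; omega
        obtain ⟨u, hu⟩ := this
        obtain ⟨hu1, hu2⟩ := mem_inter.1 hu
        exact mem_biUnion.2 ⟨u, (mem_sdiff.1 hu2).1, (h.mem_iff _ _).2 hu1⟩
      have := hVg b (mem_sdiff.2 ⟨hbN, hbG⟩)
      have he : M b \ (S₁ᶜ ∪ V.biUnion M) = M b ∩ S₂ V := by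
        ext u; simp only [S₂, mem_sdiff, mem_union, mem_compl, mem_inter]; tauto
      rw [he] at this
      omega
    have hGF₂ : d * #(G \ F₂ V) ≤ d * (2 * t) := by
      calc d * #(G \ F₂ V) = ∑ b ∈ G \ F₂ V, d := by rw [sum_const, smul_eq_mul, mul_comm]
        _ ≤ ∑ b ∈ G \ F₂ V, 2 * #(M b \ A) := by
          apply Finset.sum_le_sum
          intro b hb
          have hb := (mem_sdiff.1 hb).2
          have h1 : #(M b ∩ S₂ V) ≤ ψ := by
            by_contra hlt
            exact hb (mem_union_right _ (mem_filter.2 ⟨mem_univ _, by omega⟩))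
          have h2 : #(M b ∩ A) ≤ #(M b ∩ S₂ V) := card_le_card (inter_subset_inter_left hAS₂)
          have h3 := card_sdiff_add_card_inter (M b) A
          rw [h.deg'] at h3
          omega
        _ ≤ ∑ b ∈ G, 2 * #(M b \ A) := Finset.sum_le_sum_of_subset sdiff_subset
        _ = 2 * (d * t) := by rw [← mul_sum, h.sum_out hg']
        _ = _ := by ring
    have hGF₂' : #(G \ F₂ V) ≤ 2 * t := Nat.le_of_mul_le_mul_left hGF₂ (by omega)
    obtain ⟨U, hUA, hUc, hUg⟩ := exists_greedy N A (F₂ V) ψ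
    have hUG : U.biUnion N ⊆ G := by
      rw [hG, ← biUnion_cl K]; exact biUnion_subset_biUnion_of_subset_left N hUA
    have hUm : (ψ + 1) * #U ≤ 2 * t :=
      hUc.trans ((card_le_card (sdiff_subset_sdiff hUG (Subset.refl _))).trans hGF₂')
    have hF₃ : F₃ V U ⊆ G := union_subset hF₂ hUG
    have hAS₃ : A ⊆ S₃ V U := fun u hu => mem_filter.2 ⟨hAS₂ hu, hUg u hu⟩
    have hGF₃ : #(G \ F₃ V U) ≤ 2 * t :=
      (card_le_card (sdiff_subset_sdiff (Subset.refl _) subset_union_left)).trans hGF₂'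
    have hS₃S₂ : S₃ V U ⊆ S₂ V := filter_subset _ _
    have hS₃S₁ : S₃ V U ⊆ S₁ := hS₃S₂.trans sdiff_subset
    refine ⟨(F₃ V U, S₃ V U), mem_image.2 ⟨(V, U), mem_product.2 ⟨mem_filter.2
      ⟨mem_powerset.2 (hVX.trans sdiff_subset), hmle _ hVm⟩, mem_filter.2
      ⟨mem_powerset.2 (hUA.trans hS), hmle _ hUm⟩⟩, rfl⟩, hF₃, hAS₃, hS₃S₁, ?_⟩
    change d * #(S₃ V U) ≤ d * #(F₃ V U) + 4 * ψ * t
    have e1 : ∑ a ∈ S₃ V U, #(N a ∩ F₃ V U) ≤ d * #(F₃ V U) := by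
      rw [h.sum_inter, mul_comm, ← smul_eq_mul, ← sum_const]
      apply Finset.sum_le_sum
      intro b _
      rw [← h.deg' b]; exact card_le_card inter_subset_left
    have e2 : ∑ a ∈ A, #(N a \ F₃ V U) ≤ ψ * (2 * t) := by
      calc ∑ a ∈ A, #(N a \ F₃ V U) ≤ ∑ a ∈ A, #(N a ∩ (G \ F₃ V U)) := by
            apply Finset.sum_le_sum
            intro u hu
            apply card_le_card
            intro b hb
            obtain ⟨hb1, hb2⟩ := mem_sdiff.1 hb
            exact mem_inter.2 ⟨hb1, mem_sdiff.2 ⟨mem_cl.1 hu hb1, hb2⟩⟩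
        _ = ∑ b ∈ G \ F₃ V U, #(M b ∩ A) := h.sum_inter _ _
        _ ≤ ∑ b ∈ G \ F₃ V U, ψ := by
          apply Finset.sum_le_sum
          intro b hb
          have hb := (mem_sdiff.1 hb).2
          have h1 : #(M b ∩ S₂ V) ≤ ψ := by
            by_contra hlt
            exact hb (mem_union_left _
              (mem_union_right _ (mem_filter.2 ⟨mem_univ _, by omega⟩)))
          exact (card_le_card (inter_subset_inter_left hAS₂)).trans h1
        _ ≤ ψ * (2 * t) := by rw [sum_const, smul_eq_mul, mul_comm]; gcongr
    have e3 : ∑ a ∈ S₃ V U \ A, #(N a \ F₃ V U) ≤ ψ * (2 * t) := by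
      calc _ ≤ ∑ a ∈ S₃ V U \ A, ψ := by
            apply Finset.sum_le_sum
            intro u hu
            exact (mem_filter.1 (mem_sdiff.1 hu).1).2
        _ ≤ ψ * (2 * t) := by
          rw [sum_const, smul_eq_mul, mul_comm]
          gcongr
          exact (card_le_card (sdiff_subset_sdiff hS₃S₁ (Subset.refl _))).trans hSout
    have e4 : d * #(S₃ V U) = ∑ a ∈ S₃ V U, #(N a ∩ F₃ V U) +
        (∑ a ∈ S₃ V U \ A, #(N a \ F₃ V U) + ∑ a ∈ A, #(N a \ F₃ V U)) := by
      rw [sum_sdiff hAS₃, ← sum_add_distrib, mul_comm, ← smul_eq_mul, ← sum_const]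
      apply Finset.sum_congr rfl
      intro u _
      rw [add_comm, card_sdiff_add_card_inter, h.deg]
    rw [e4]
    nlinarith

end

lemma eventually_log_le_mul (ε : ℝ) (hε : 0 < ε) : ∀ᶠ q : ℝ in Filter.atTop, Real.log q ≤ ε * q := by
  filter_upwards [Real.isLittleO_log_id_atTop.bound hε, Filter.eventually_ge_atTop 0] with q hq h0
  simp only [id, Real.norm_eq_abs, abs_of_nonneg h0] at hq
  exact (le_abs_self _).trans hq

lemma container_numeric_aux {q g t : ℝ} (hlog : Real.log q ≤ 1 / 10000 * q) (hq : 10000 ≤ q)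
    (ht : 0 ≤ t) (hgt : g ≤ 3 * q ^ 2 * t) (hdg : (q ^ 4) ^ 2 ≤ 8 * g) :
    Real.exp (2 * g / q ^ 4 * Real.log (3 * (q ^ 4) ^ 6) + 1) *
      Real.exp (2 * (2 * t / q ^ 2 * Real.log ((q ^ 4) ^ 3) + 2 * g / (q ^ 4) ^ 2)) *
      (Real.exp (Real.log 2 * (g - t / q + 4 * t / q ^ 2)) +
        Real.exp (t / q * Real.log ((q ^ 4) ^ 3) + 2 * g / (q ^ 4) ^ 2) *
          Real.exp (Real.log 2 * (g - t))) ≤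
      Real.exp (Real.log 2 * g) * Real.exp (-3 * q ^ 4) := by
  have hq0 : 0 < q := by linarith
  have hl0 : 0 ≤ Real.log q := Real.log_nonneg (by linarith)
  have hl6 : Real.log (3 * (q ^ 4) ^ 6) ≤ 24 * Real.log q + 2 := by
    rw [Real.log_mul (by norm_num) (by positivity), ← pow_mul, Real.log_pow]
    have : Real.log 3 ≤ 2 := by
      have := Real.log_le_sub_one_of_pos (show (0 : ℝ) < 3 by norm_num)
      linarith
    push_cast
    linarith
  have hl3 : Real.log ((q ^ 4) ^ 3) = 12 * Real.log q := by
    rw [← pow_mul, Real.log_pow]; push_cast; ring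
  rw [hl3]
  have hln2 := Real.log_two_gt_d9
  have hln2' := Real.log_two_lt_d9
  set s := t / q with hs
  have hts : t = s * q := by rw [hs]; field_simp
  have hs0 : 0 ≤ s := by positivity
  have hg0 : 0 ≤ g := by nlinarith [sq_nonneg (q ^ 4)]
  have hgs : g ≤ 3 * q ^ 3 * s := by rw [hts] at hgt; linarith
  -- the individual error terms
  have hl6' : Real.log (3 * (q ^ 4) ^ 6) ≤ 24 * (1 / 10000 * q) + 2 * (1 / 10000 * q) :=
    hl6.trans (by linarith)
  have b1 : 2 * g / q ^ 4 * Real.log (3 * (q ^ 4) ^ 6) ≤ s * (1 / 50) := by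
    calc 2 * g / q ^ 4 * Real.log (3 * (q ^ 4) ^ 6)
        ≤ 2 * (3 * q ^ 3 * s) / q ^ 4 * (24 * (1 / 10000 * q) + 2 * (1 / 10000 * q)) := by
          gcongr
          exact Real.log_nonneg (by
            have : (1 : ℝ) ≤ (q ^ 4) ^ 6 := one_le_pow₀ (one_le_pow₀ (by linarith))
            linarith)
      _ = s * (156 / 10000) := by field_simp; ring
      _ ≤ s * (1 / 50) := mul_le_mul_of_nonneg_left (by norm_num) hs0
  have b2 : 2 * t / q ^ 2 * (12 * Real.log q) ≤ s * (1 / 50) := by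
    calc 2 * t / q ^ 2 * (12 * Real.log q) ≤ 2 * (s * q) / q ^ 2 * (12 * (1 / 10000 * q)) := by
          rw [hts]; gcongr
      _ = s * (24 / 10000) := by field_simp; ring
      _ ≤ s * (1 / 50) := mul_le_mul_of_nonneg_left (by norm_num) hs0
  have b3 : 2 * g / (q ^ 4) ^ 2 ≤ s * (1 / 50) := by
    have : (1 : ℝ) ≤ q ^ 4 := one_le_pow₀ (by linarith)
    calc 2 * g / (q ^ 4) ^ 2 ≤ 2 * (3 * q ^ 3 * s) / (q ^ 4 * q ^ 4) := by
          rw [sq]; gcongr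
      _ = s * (6 / (q * q ^ 4)) := by field_simp; ring
      _ ≤ s * (1 / 50) := by
        refine mul_le_mul_of_nonneg_left ?_ hs0
        rw [div_le_div_iff₀ (by positivity) (by norm_num)]
        nlinarith
  have b4 : 4 * t / q ^ 2 ≤ s * (1 / 50) := by
    calc 4 * t / q ^ 2 = s * (4 / q) := by rw [hts]; field_simp
      _ ≤ s * (1 / 50) := by
        refine mul_le_mul_of_nonneg_left ?_ hs0
        rw [div_le_div_iff₀ (by positivity) (by norm_num)]
        linarith
  have b5 : s * (12 * Real.log q) ≤ t * (1 / 50) := by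
    rw [hts]
    calc s * (12 * Real.log q) ≤ s * (12 * (1 / 10000 * q)) := by gcongr
      _ ≤ s * q * (1 / 50) := by nlinarith
  have hst : s ≤ t := by rw [hts]; nlinarith
  have hbig : 3 * q ^ 4 + 2 ≤ s * (1 / 4) := by
    have h1 : q ^ 5 ≤ 24 * s := by
      have : q ^ 3 * q ^ 5 ≤ q ^ 3 * (24 * s) := by
        calc q ^ 3 * q ^ 5 = (q ^ 4) ^ 2 := by ring
          _ ≤ 8 * g := hdg
          _ ≤ q ^ 3 * (24 * s) := by linarith
      exact le_of_mul_le_mul_left this (by positivity)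
    have h2 : (1 : ℝ) ≤ q ^ 4 := one_le_pow₀ (by linarith)
    have h3 : 10000 * q ^ 4 ≤ q ^ 5 := by
      rw [pow_succ q 4]; nlinarith
    nlinarith
  rw [mul_add, ← Real.exp_add, ← Real.exp_add, ← Real.exp_add, ← Real.exp_add, ← Real.exp_add]
  have f1 : ∀ x : ℝ, x ≤ Real.log 2 * g + -3 * q ^ 4 - 1 →
      Real.exp x ≤ Real.exp (Real.log 2 * g + -3 * q ^ 4) * (1 / 2) := by
    intro x hx
    have : Real.exp (-1) ≤ 1 / 2 := by
      rw [Real.exp_neg, one_div]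
      apply inv_anti₀ (by norm_num)
      linarith [Real.add_one_le_exp 1]
    calc Real.exp x ≤ Real.exp (Real.log 2 * g + -3 * q ^ 4 + -1) := Real.exp_le_exp.2 (by linarith)
      _ = Real.exp (Real.log 2 * g + -3 * q ^ 4) * Real.exp (-1) := Real.exp_add _ _
      _ ≤ _ := by gcongr
  have g1 := f1 (2 * g / q ^ 4 * Real.log (3 * (q ^ 4) ^ 6) + 1 +
      2 * (2 * t / q ^ 2 * (12 * Real.log q) + 2 * g / (q ^ 4) ^ 2) +
      Real.log 2 * (g - s + 4 * t / q ^ 2)) (by nlinarith)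
  have g2 := f1 (2 * g / q ^ 4 * Real.log (3 * (q ^ 4) ^ 6) + 1 +
      2 * (2 * t / q ^ 2 * (12 * Real.log q) + 2 * g / (q ^ 4) ^ 2) +
      (s * (12 * Real.log q) + 2 * g / (q ^ 4) ^ 2 + Real.log 2 * (g - t))) (by nlinarith)
  linarith

/-- The numerical inequality behind the container bound. -/
lemma container_numeric : ∃ d₀ : ℕ, 4 ≤ d₀ ∧ ∀ d : ℕ, d₀ ≤ d → ∀ g t : ℝ, 0 ≤ t →
    g ≤ 3 * √d * t → (d : ℝ) ^ 2 ≤ 8 * g →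
    Real.exp (2 * g / d * Real.log (3 * d ^ 6) + 1) *
      Real.exp (2 * (2 * t / √d * Real.log (d ^ 3) + 2 * g / (d : ℝ) ^ 2)) *
      (Real.exp (Real.log 2 * (g - t / √√d + 4 * t / √d)) +
        Real.exp (t / √√d * Real.log (d ^ 3) + 2 * g / (d : ℝ) ^ 2) *
          Real.exp (Real.log 2 * (g - t))) ≤
      Real.exp (Real.log 2 * g) * Real.exp (-3 * d) := by
  have hlim : Filter.Tendsto (fun d : ℕ => √√(d : ℝ)) Filter.atTop Filter.atTop :=
    Real.tendsto_sqrt_atTop.comp (Real.tendsto_sqrt_atTop.comp tendsto_natCast_atTop_atTop)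
  have hev := hlim.eventually ((eventually_log_le_mul (1 / 10000) (by norm_num)).and
    (Filter.eventually_ge_atTop (10000 : ℝ)))
  obtain ⟨d₀, hd₀⟩ := Filter.eventually_atTop.1 hev
  refine ⟨max d₀ 4, le_max_right _ _, fun d hd g t ht hgt hdg => ?_⟩
  obtain ⟨hlog, hq⟩ := hd₀ d ((le_max_left _ _).trans hd)
  generalize hqdef : √√(d : ℝ) = q at *
  have hX : √(d : ℝ) = q ^ 2 := by
    rw [← hqdef]; exact (Real.sq_sqrt (Real.sqrt_nonneg _)).symm
  have hd4 : (d : ℝ) = q ^ 4 := by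
    rw [← Real.sq_sqrt (Nat.cast_nonneg d : (0 : ℝ) ≤ d), hX]; ring
  rw [hX] at hgt ⊢
  rw [hd4] at hdg ⊢
  exact container_numeric_aux hlog hq ht hgt hdg

section
variable {α β : Type*} [Fintype α] [Fintype β] [DecidableEq α] [DecidableEq β]
  {d : ℕ} {N : α → Finset β} {M : β → Finset α}

/-- Approximations `(F, S)` of the neighbourhood and the closure of a linked set. -/
lemma CubeLike.approx (h : CubeLike d N M) (hd : 4 ≤ d) (v : α) (a t : ℕ) :
    ∃ 𝒜 : Finset (Finset β × Finset α),
      (#𝒜 : ℝ) ≤ Real.exp (2 * (a + t : ℝ) / d * Real.log (3 * d ^ 6) + 1) *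
        Real.exp (2 * (2 * t / √d * Real.log (d ^ 3) + 2 * (a + t : ℝ) / (d : ℝ) ^ 2)) ∧
      (∀ p ∈ 𝒜, #p.2 ≤ 2 * (a + t)) ∧
      ∀ K : Finset α, v ∈ K → Linked N K → #(cl N K) = a → #(K.biUnion N) = a + t →
        ∃ p ∈ 𝒜, p.1 ⊆ K.biUnion N ∧ cl N K ⊆ p.2 ∧
          d * #p.2 ≤ d * #p.1 + 4 * Nat.sqrt d * t := by
  classical
  obtain ⟨𝒰, h𝒰, hcover⟩ := h.coarse (by omega) v a t
  let S₁ : Finset α → Finset α := fun U => univ.filter fun u => d ≤ 2 * #(N u ∩ U.biUnion N)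
  have hex := fun U : Finset α => fun hS : #(S₁ U) ≤ 2 * (a + t) =>
    h.refine hd a t (U.biUnion N) (S₁ U) hS
  choose! 𝓑 h𝓑 h𝓑' using hex
  let 𝒰' := 𝒰.filter fun U => #(S₁ U) ≤ 2 * (a + t)
  refine ⟨𝒰'.biUnion fun U => (𝓑 U).filter fun p => p.2 ⊆ S₁ U, ?_, ?_, ?_⟩
  · calc (#(𝒰'.biUnion fun U => (𝓑 U).filter fun p => p.2 ⊆ S₁ U) : ℝ)
        ≤ ∑ U ∈ 𝒰', (#((𝓑 U).filter fun p => p.2 ⊆ S₁ U) : ℝ) := by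
          exact_mod_cast Finset.card_biUnion_le
      _ ≤ ∑ U ∈ 𝒰', Real.exp
            (2 * (2 * t / √d * Real.log (d ^ 3) + 2 * (a + t : ℝ) / (d : ℝ) ^ 2)) := by
          apply Finset.sum_le_sum
          intro U hU
          refine le_trans ?_ (h𝓑 U (mem_filter.1 hU).2)
          exact_mod_cast card_filter_le _ _
      _ ≤ _ := by
          rw [sum_const, nsmul_eq_mul]
          gcongr
          refine le_trans ?_ h𝒰
          exact_mod_cast card_filter_le _ _
  · intro p hp
    obtain ⟨U, hU, hp⟩ := mem_biUnion.1 hp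
    exact (card_le_card (mem_filter.1 hp).2).trans (mem_filter.1 hU).2
  · intro K hv hK ha hg
    obtain ⟨U, hU, hUK, hnear⟩ := hcover K hv hK ha hg
    have hd0 : 0 < d := by omega
    have hS : #(S₁ U) ≤ 2 * (a + t) := by
      have h1 : #(S₁ U) ≤ 2 * #(U.biUnion N) :=
        Nat.le_of_mul_le_mul_left (h.card_core_le (U.biUnion N)) hd0
      have h2 := card_le_card hUK
      omega
    have hout : #(S₁ U \ cl N K) ≤ 2 * t :=
      Nat.le_of_mul_le_mul_left (h.card_core_sdiff_le hUK (by rw [hg, ha])) hd0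
    obtain ⟨p, hp, hp1, hp2, hp3, hp4⟩ := h𝓑' U hS K ha hg hUK
      (fun u hu => mem_filter.2 ⟨mem_univ _, hnear u hu⟩) hout
    exact ⟨p, mem_biUnion.2 ⟨U, mem_filter.2 ⟨hU, hS⟩, mem_filter.2 ⟨hp, hp3⟩⟩, hp1, hp2, hp4⟩

/-- A cheap family of containers for the linked sets of given closure and neighbourhood size. -/
lemma exists_containers : ∃ d₀ : ℕ, 4 ≤ d₀ ∧ ∀ (d : ℕ), d₀ ≤ d →
    ∀ {α β : Type} [Fintype α] [Fintype β] [DecidableEq α] [DecidableEq β]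
    {N : α → Finset β} {M : β → Finset α}, CubeLike d N M → ∀ (v : α) (a g : ℕ),
    2 * a ≤ Fintype.card α → d ^ 2 ≤ 8 * g →
    ∃ 𝒞 : Finset (Finset α),
      (∀ K : Finset α, v ∈ K → Linked N K → #(cl N K) = a → #(K.biUnion N) = g →
        ∃ S ∈ 𝒞, K ⊆ S) ∧
      ∑ S ∈ 𝒞, (2 : ℝ) ^ #S ≤ 2 ^ g * Real.exp (-3 * d) := by
  classical
  obtain ⟨d₀, hd₀4, hnum⟩ := container_numeric
  refine ⟨d₀, hd₀4, fun d hd α β _ _ _ _ N M h v a g ha hdg => ?_⟩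
  have hd4 : 4 ≤ d := hd₀4.trans hd
  by_cases hex : ∃ K : Finset α, v ∈ K ∧ Linked N K ∧ #(cl N K) = a ∧ #(K.biUnion N) = g
  swap
  · refine ⟨∅, fun K h1 h2 h3 h4 => absurd ⟨K, h1, h2, h3, h4⟩ hex, ?_⟩
    rw [sum_empty]
    positivity
  obtain ⟨K₀, -, -, hK₀a, hK₀g⟩ := hex
  have hd0 : (0 : ℝ) < d := by exact_mod_cast (by omega : 0 < d)
  have hX1 : 1 ≤ √(d : ℝ) := by
    rw [Real.one_le_sqrt]; exact_mod_cast (by omega : 1 ≤ d)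
  have hiso := h.iso (cl N K₀) (by rw [hK₀a]; exact ha)
  rw [biUnion_cl, hK₀a, hK₀g] at hiso
  have hag : a ≤ g := by
    have : (0 : ℝ) ≤ (g : ℝ) - a := by
      by_contra! hlt
      have : (0 : ℝ) ≤ a := Nat.cast_nonneg _
      nlinarith
    exact_mod_cast (sub_nonneg.1 this)
  obtain ⟨t, rfl⟩ := Nat.exists_eq_add_of_le hag
  push_cast at hiso
  have hgt : ((a : ℝ) + t) ≤ 3 * √d * t := by
    have : (0 : ℝ) ≤ t := Nat.cast_nonneg _
    nlinarith
  have hdg' : (d : ℝ) ^ 2 ≤ 8 * (a + t) := by exact_mod_cast hdg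
  have hnum := hnum d hd (a + t) t (Nat.cast_nonneg _) hgt hdg'
  obtain ⟨𝒜, h𝒜, h𝒜2, hcov⟩ := h.approx hd4 v a t
  set s : ℝ := t / √√d with hs
  let big : Finset (Finset α) := 𝒜.image (fun p => p.2) |>.filter fun S =>
    (#S : ℝ) ≤ a + t - s + 4 * t / √d
  let ℋ : Finset β × Finset α → Finset (Finset β) := fun p =>
    (p.2.biUnion N).powerset.filter fun H => (#H : ℝ) ≤ s
  let small : Finset (Finset α) := (𝒜.biUnion fun p =>
    (ℋ p).image fun H => interior N (p.1 ∪ H)).filter fun S => #S = a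
  have hpow : ∀ k : ℕ, (2 : ℝ) ^ k = Real.exp (Real.log 2 * k) := by
    intro k
    rw [mul_comm, Real.exp_nat_mul, Real.exp_log (by norm_num)]
  refine ⟨big ∪ small, ?_, ?_⟩
  · intro K hv hK hKa hKg
    obtain ⟨p, hp, hp1, hp2, hp3⟩ := hcov K hv hK hKa hKg
    by_cases hc : (#p.2 : ℝ) ≤ a + t - s + 4 * t / √d
    · exact ⟨p.2, mem_union_left _ (mem_filter.2 ⟨mem_image_of_mem _ hp, hc⟩),
        (subset_cl K).trans hp2⟩
    · refine ⟨cl N K, mem_union_right _ (mem_filter.2 ⟨mem_biUnion.2 ⟨p, hp, mem_image.2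
        ⟨K.biUnion N \ p.1, mem_filter.2 ⟨mem_powerset.2 ?_, ?_⟩, ?_⟩⟩, hKa⟩), subset_cl K⟩
      · exact sdiff_subset.trans
          (biUnion_subset_biUnion_of_subset_left N ((subset_cl K).trans hp2))
      · push Not at hc
        have h1 : #(K.biUnion N \ p.1) + #p.1 = a + t := by
          rw [card_sdiff_add_card_eq_card hp1, hKg]
        have h1' : (#(K.biUnion N \ p.1) : ℝ) + #p.1 = a + t := by exact_mod_cast h1
        have h2 : (#p.2 : ℝ) ≤ #p.1 + 4 * t / √d := by
          have h3 : (d : ℝ) * #p.2 ≤ d * #p.1 + 4 * Nat.sqrt d * t := by exact_mod_cast hp3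
          have h4 : (Nat.sqrt d : ℝ) ≤ √d := Real.nat_sqrt_le_real_sqrt
          have h5 : (d : ℝ) * #p.2 ≤ d * (#p.1 + 4 * t / √d) := by
            calc (d : ℝ) * #p.2 ≤ d * #p.1 + 4 * √d * t := h3.trans (by gcongr)
              _ = d * #p.1 + √d * √d * (4 * t / √d) := by field_simp
              _ = _ := by rw [Real.mul_self_sqrt hd0.le]; ring
          exact le_of_mul_le_mul_left h5 hd0
        linarith
      · simp only [union_sdiff_of_subset hp1]
        rfl
  · have e1 : ∑ S ∈ big, (2 : ℝ) ^ #S ≤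
        #𝒜 * Real.exp (Real.log 2 * (a + t - s + 4 * t / √d)) := by
      calc ∑ S ∈ big, (2 : ℝ) ^ #S
          ≤ ∑ S ∈ big, Real.exp (Real.log 2 * (a + t - s + 4 * t / √d)) := by
            apply Finset.sum_le_sum
            intro S hS
            rw [hpow]
            apply Real.exp_le_exp.2
            exact mul_le_mul_of_nonneg_left (mem_filter.1 hS).2 (Real.log_nonneg (by norm_num))
        _ ≤ _ := by
          rw [sum_const, nsmul_eq_mul]
          gcongr
          exact (card_filter_le _ _).trans card_image_le
    have e2 : ∑ S ∈ small, (2 : ℝ) ^ #S ≤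
        #𝒜 * (Real.exp (s * Real.log (d ^ 3) + 2 * (a + t) / (d : ℝ) ^ 2) *
          Real.exp (Real.log 2 * (a + t - t))) := by
      calc ∑ S ∈ small, (2 : ℝ) ^ #S
          = ∑ S ∈ small, Real.exp (Real.log 2 * (a + t - t)) := by
            apply Finset.sum_congr rfl
            intro S hS
            rw [(mem_filter.1 hS).2, hpow]; ring_nf
        _ = #small * Real.exp (Real.log 2 * (a + t - t)) := by
          rw [sum_const, nsmul_eq_mul]
        _ ≤ (#𝒜 * Real.exp (s * Real.log (d ^ 3) + 2 * (a + t) / (d : ℝ) ^ 2)) *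
            Real.exp (Real.log 2 * (a + t - t)) := by
          gcongr
          calc (#small : ℝ) ≤ ∑ p ∈ 𝒜, (#((ℋ p).image fun H => interior N (p.1 ∪ H)) : ℝ) := by
                exact_mod_cast (card_filter_le _ _).trans card_biUnion_le
            _ ≤ ∑ p ∈ 𝒜, Real.exp (s * Real.log (d ^ 3) + 2 * (a + t) / (d : ℝ) ^ 2) := by
              apply Finset.sum_le_sum
              intro p hp
              have hd3 : (1 : ℝ) ≤ d ^ 3 :=
                one_le_pow₀ (by exact_mod_cast (by omega : 1 ≤ d))
              calc (#((ℋ p).image fun H => interior N (p.1 ∪ H)) : ℝ) ≤ #(ℋ p) := by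
                    exact_mod_cast card_image_le
                _ ≤ _ := card_small_subsets_le _ s (d ^ 3) hd3
                _ ≤ _ := by
                  apply Real.exp_le_exp.2
                  have h1 : (#(p.2.biUnion N) : ℝ) ≤ d * #p.2 := by
                    exact_mod_cast h.card_biUnion_le p.2
                  have h3 : (#p.2 : ℝ) ≤ 2 * (a + t) := by exact_mod_cast h𝒜2 p hp
                  have h2 : (#(p.2.biUnion N) : ℝ) / d ^ 3 ≤ 2 * (a + t) / (d : ℝ) ^ 2 := by
                    rw [div_le_div_iff₀ (by positivity) (by positivity)]
                    calc (#(p.2.biUnion N) : ℝ) * d ^ 2 ≤ (d * (2 * (a + t))) * d ^ 2 := by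
                          gcongr; exact h1.trans (by gcongr)
                      _ = _ := by ring
                  linarith
            _ = _ := by rw [sum_const, nsmul_eq_mul]
        _ = _ := by ring
    calc ∑ S ∈ big ∪ small, (2 : ℝ) ^ #S
        ≤ ∑ S ∈ big, (2 : ℝ) ^ #S + ∑ S ∈ small, (2 : ℝ) ^ #S := by
          rw [← sum_union_inter]
          exact le_add_of_nonneg_right (sum_nonneg fun _ _ => by positivity)
      _ ≤ #𝒜 * (Real.exp (Real.log 2 * (a + t - s + 4 * t / √d)) +
          (Real.exp (s * Real.log (d ^ 3) + 2 * (a + t) / (d : ℝ) ^ 2) *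
          Real.exp (Real.log 2 * (a + t - t)))) := by
          rw [mul_add]; exact add_le_add e1 e2
      _ ≤ _ := by
          rw [hpow]
          push_cast
          refine le_trans ?_ hnum
          gcongr

end

lemma sum_biUnion_le {ι κ : Type*} [DecidableEq κ] (s : Finset ι) (t : ι → Finset κ)
    {f : κ → ℝ} (hf : ∀ x, 0 ≤ f x) :
    ∑ x ∈ s.biUnion t, f x ≤ ∑ i ∈ s, ∑ x ∈ t i, f x := by
  classical
  induction s using Finset.induction_on with
  | empty => simp
  | insert i s hi ih =>
    rw [biUnion_insert, sum_insert hi]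
    have := sum_union_inter (s₁ := t i) (s₂ := s.biUnion t) (f := f)
    have h2 := sum_nonneg fun x (_ : x ∈ t i ∩ s.biUnion t) => hf x
    linarith

section
variable {α β : Type*} [Fintype α] [Fintype β] [DecidableEq α] [DecidableEq β]
  {d : ℕ} {N : α → Finset β} {M : β → Finset α}

/-! ### Polymer expansion -/

lemma linked_singleton (v : α) : Linked N {v} := by
  intro W hW hne hW'
  rcases subset_singleton_iff.1 hW with rfl | rfl
  · simp at hne
  · exact absurd rfl hW'

lemma Linked.insert {K : Finset α} (hK : Linked N K) {u w : α} (hw : w ∈ K)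
    (huw : (N w ∩ N u).Nonempty) : Linked N (insert u K) := by
  by_cases hu : u ∈ K
  · rwa [insert_eq_of_mem hu]
  intro W hW hne hW'
  by_cases huW : u ∈ W
  · by_cases hWK : (W ∩ K).Nonempty
    · have hne' : W ∩ K ≠ K := fun h => hW' (by
        apply subset_antisymm hW
        apply insert_subset huW
        rw [← h]; exact inter_subset_left)
      obtain ⟨x, hx, y, hy, hxy⟩ := hK _ inter_subset_right hWK hne'
      refine ⟨x, (mem_inter.1 hx).1, y, ?_, hxy⟩
      simp only [mem_sdiff, mem_inter, not_and, mem_insert] at hy ⊢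
      exact ⟨Or.inr hy.1, fun h => hy.2 h hy.1⟩
    · rw [not_nonempty_iff_eq_empty] at hWK
      refine ⟨u, huW, w, mem_sdiff.2 ⟨mem_insert_of_mem hw, fun h => ?_⟩, by rwa [inter_comm]⟩
      have : w ∈ W ∩ K := mem_inter.2 ⟨h, hw⟩
      simp [hWK] at this
  · have hWK : W ⊆ K := fun x hx => (mem_insert.1 (hW hx)).resolve_left fun h => huW (h ▸ hx)
    by_cases hE : W = K
    · subst hE
      exact ⟨w, hw, u, by simp [huW], huw⟩
    · obtain ⟨x, hx, y, hy, hxy⟩ := hK _ hWK hne hE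
      refine ⟨x, hx, y, ?_, hxy⟩
      simp only [mem_sdiff, mem_insert] at hy ⊢
      exact ⟨Or.inr hy.1, hy.2⟩

lemma exists_component (N : α → Finset β) {T : Finset α} {v : α} (hv : v ∈ T) :
    ∃ K ⊆ T, v ∈ K ∧ Linked N K ∧ Disjoint (K.biUnion N) ((T \ K).biUnion N) := by
  classical
  obtain ⟨K, hK, hmax⟩ := exists_max_image (T.powerset.filter fun K => v ∈ K ∧ Linked N K) card
    ⟨{v}, by simp [hv, linked_singleton]⟩
  simp only [mem_filter, mem_powerset] at hK hmax
  refine ⟨K, hK.1, hK.2.1, hK.2.2, ?_⟩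
  rw [disjoint_left]
  intro b hb hb'
  obtain ⟨w, hw, hbw⟩ := mem_biUnion.1 hb
  obtain ⟨u, hu, hbu⟩ := mem_biUnion.1 hb'
  rw [mem_sdiff] at hu
  have := hmax (insert u K) ⟨insert_subset hu.1 hK.1, mem_insert_of_mem hK.2.1,
    hK.2.2.insert hw ⟨b, mem_inter.2 ⟨hbw, hbu⟩⟩⟩
  rw [card_insert_of_notMem hu.2] at this
  omega

/-- A set of vertices whose closure covers at most half of its side. -/
def Small (N : α → Finset β) (T : Finset α) : Prop := 2 * #(cl N T) ≤ Fintype.card α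

lemma cl_mono {K T : Finset α} (h : K ⊆ T) : cl N K ⊆ cl N T := fun _ ha =>
  mem_cl.2 ((mem_cl.1 ha).trans (biUnion_subset_biUnion_of_subset_left N h))

lemma Small.mono {K T : Finset α} (hT : Small N T) (h : K ⊆ T) : Small N K :=
  (Nat.mul_le_mul_left 2 (card_le_card (cl_mono h))).trans hT

/-- Weights compatible with the decomposition into components. -/
structure PolymerWeight (d : ℕ) (N : α → Finset β) (C : ℝ) (w : Finset α → ℝ) : Prop where
  nonneg : ∀ T, 0 ≤ w T
  mul : ∀ K T, Disjoint (K.biUnion N) (T.biUnion N) → w (K ∪ T) = w K * w T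
  sum_le : ∀ S : Finset α, ∑ U ∈ S.powerset, w U ≤ C * 2 ^ #S
  one : ∀ K, 4 * #K ≤ d → w K = 1

/-- The activity of a set of vertices. -/
noncomputable def act (N : α → Finset β) (w : Finset α → ℝ) (T : Finset α) : ℝ :=
  w T * (1 / 2) ^ #(T.biUnion N)

open Classical in
/-- The linked small sets containing `v`. -/
noncomputable def comps (N : α → Finset β) (v : α) : Finset (Finset α) :=
  univ.filter fun K => v ∈ K ∧ Linked N K ∧ Small N K

/-- The linked small sets with at least two elements containing `v`. -/
noncomputable def bigComps (N : α → Finset β) (v : α) : Finset (Finset α) :=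
  (comps N v).filter fun K => 2 ≤ #K

open Classical in
/-- The small subsets of `P`. -/
noncomputable def smalls (N : α → Finset β) (P : Finset α) : Finset (Finset α) :=
  P.powerset.filter (Small N)

/-- Some two distinct vertices of `T` share a neighbour. -/
def Clustered (N : α → Finset β) (T : Finset α) : Prop :=
  ∃ v ∈ T, ∃ u ∈ T, u ≠ v ∧ (N v ∩ N u).Nonempty

variable {C : ℝ} {w : Finset α → ℝ}

lemma PolymerWeight.act_nonneg (hw : PolymerWeight d N C w) (T : Finset α) : 0 ≤ act N w T :=
  mul_nonneg (hw.nonneg T) (by positivity)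

lemma PolymerWeight.act_mul (hw : PolymerWeight d N C w) {K T : Finset α}
    (h : Disjoint (K.biUnion N) (T.biUnion N)) : act N w (K ∪ T) = act N w K * act N w T := by
  rw [act, act, act, hw.mul K T h, union_biUnion, card_union_of_disjoint h, pow_add]
  ring

lemma PolymerWeight.sum_le_mul (hw : PolymerWeight d N C w) {X 𝒦 𝒯 : Finset (Finset α)}
    (h : ∀ T ∈ X, ∃ K ∈ 𝒦, K ⊆ T ∧ T \ K ∈ 𝒯 ∧ Disjoint (K.biUnion N) ((T \ K).biUnion N)) :
    ∑ T ∈ X, act N w T ≤ (∑ K ∈ 𝒦, act N w K) * ∑ T ∈ 𝒯, act N w T := by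
  classical
  choose! κ hκ hsub hdiff hdisj using h
  rw [sum_mul_sum, ← sum_product']
  have hinj : Set.InjOn (fun T => (κ T, T \ κ T)) (X : Set (Finset α)) := by
    intro T hT T' hT' hE
    simp only [Prod.mk.injEq] at hE
    rw [← union_sdiff_of_subset (hsub T hT), ← union_sdiff_of_subset (hsub T' hT'), hE.2, hE.1]
  calc ∑ T ∈ X, act N w T
      = ∑ T ∈ X, act N w (κ T) * act N w (T \ κ T) := by
        refine sum_congr rfl fun T hT => ?_
        rw [← hw.act_mul (hdisj T hT), union_sdiff_of_subset (hsub T hT)]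
    _ = ∑ p ∈ X.image (fun T => (κ T, T \ κ T)), act N w p.1 * act N w p.2 :=
        (sum_image (f := fun p => act N w p.1 * act N w p.2) hinj).symm
    _ ≤ _ := by
        apply sum_le_sum_of_subset_of_nonneg
        · intro p hp
          obtain ⟨T, hT, rfl⟩ := mem_image.1 hp
          exact mem_product.2 ⟨hκ T hT, hdiff T hT⟩
        · intro p _ _
          exact mul_nonneg (hw.act_nonneg _) (hw.act_nonneg _)

lemma PolymerWeight.partition_insert (hw : PolymerWeight d N C w) (P : Finset α) (v : α) :
    ∑ T ∈ smalls N (insert v P), act N w T ≤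
      (1 + ∑ K ∈ comps N v, act N w K) * ∑ T ∈ smalls N P, act N w T := by
  classical
  rw [add_mul, one_mul, ← sum_filter_add_sum_filter_not _ (fun T => v ∉ T)]
  apply add_le_add
  · apply sum_le_sum_of_subset_of_nonneg
    · intro T hT
      simp only [smalls, mem_filter, mem_powerset] at hT ⊢
      exact ⟨(subset_insert_iff_of_notMem hT.2).1 hT.1.1, hT.1.2⟩
    · intro T _ _
      exact hw.act_nonneg T
  · apply hw.sum_le_mul
    intro T hT
    simp only [smalls, mem_filter, mem_powerset, not_not] at hT
    obtain ⟨K, hKT, hvK, hK, hdis⟩ := exists_component N hT.2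
    refine ⟨K, ?_, hKT, ?_, hdis⟩
    · simp only [comps, mem_filter, mem_univ, true_and]
      exact ⟨hvK, hK, hT.1.2.mono hKT⟩
    · simp only [smalls, mem_filter, mem_powerset]
      refine ⟨fun x hx => ?_, hT.1.2.mono sdiff_subset⟩
      rw [mem_sdiff] at hx
      exact (mem_insert.1 (hT.1.1 hx.1)).resolve_left fun h => hx.2 (h ▸ hvK)

lemma PolymerWeight.partition_le (hw : PolymerWeight d N C w) (P : Finset α) :
    ∑ T ∈ smalls N P, act N w T ≤ ∏ v ∈ P, (1 + ∑ K ∈ comps N v, act N w K) := by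
  classical
  induction P using Finset.induction_on with
  | empty =>
    have : smalls N ∅ ⊆ {∅} := fun T hT => by
      simp only [smalls, mem_filter, mem_powerset, subset_empty] at hT
      simp [hT.1]
    refine (sum_le_sum_of_subset_of_nonneg this fun T _ _ => hw.act_nonneg T).trans ?_
    simp [act, hw.one ∅]
  | insert v P hv ih =>
    rw [prod_insert hv]
    refine (hw.partition_insert P v).trans (mul_le_mul_of_nonneg_left ih ?_)
    have := sum_nonneg fun K (_ : K ∈ comps N v) => hw.act_nonneg K
    linarith

open Classical in
lemma PolymerWeight.clustered_le (hw : PolymerWeight d N C w) :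
    ∑ T ∈ (smalls N univ).filter (Clustered N), act N w T ≤
      (∑ v, ∑ K ∈ bigComps N v, act N w K) * ∑ T ∈ smalls N univ, act N w T := by
  rw [sum_mul]
  have hsub : (smalls N univ).filter (Clustered N) ⊆ univ.biUnion fun v =>
      (smalls N univ).filter fun T => v ∈ T ∧ ∃ u ∈ T, u ≠ v ∧ (N v ∩ N u).Nonempty := by
    intro T hT
    obtain ⟨hT, v, hv, hu⟩ := mem_filter.1 hT
    exact mem_biUnion.2 ⟨v, mem_univ _, mem_filter.2 ⟨hT, hv, hu⟩⟩
  refine (sum_le_sum_of_subset_of_nonneg hsub fun T _ _ => hw.act_nonneg T).trans ?_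
  refine (sum_biUnion_le _ _ hw.act_nonneg).trans (sum_le_sum fun v _ => ?_)
  apply hw.sum_le_mul
  intro T hT
  simp only [smalls, mem_filter, mem_powerset] at hT
  obtain ⟨⟨-, hsm⟩, hv, u, hu, huv, b, hb⟩ := hT
  obtain ⟨K, hKT, hvK, hK, hdis⟩ := exists_component N hv
  rw [mem_inter] at hb
  refine ⟨K, ?_, hKT, ?_, hdis⟩
  · simp only [bigComps, comps, mem_filter, mem_univ, true_and]
    refine ⟨⟨hvK, hK, hsm.mono hKT⟩, ?_⟩
    have huK : u ∈ K := by
      by_contra h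
      exact disjoint_left.1 hdis (mem_biUnion.2 ⟨v, hvK, hb.1⟩)
        (mem_biUnion.2 ⟨u, mem_sdiff.2 ⟨hu, h⟩, hb.2⟩)
    exact one_lt_card.2 ⟨u, huK, v, hvK, huv⟩
  · simp only [smalls, mem_filter, mem_powerset]
    exact ⟨subset_univ _, hsm.mono sdiff_subset⟩

end

/-! ### Linked sets with at least two vertices are rare -/

section
variable {α β : Type*} [Fintype α] [Fintype β] [DecidableEq α] [DecidableEq β]
  {d : ℕ} {N : α → Finset β} {M : β → Finset α} {C : ℝ} {w : Finset α → ℝ}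

lemma CubeLike.le_card_biUnion (h : CubeLike d N M) (K : Finset α) :
    d * #K ≤ #(K.biUnion N) + #K * #K := by
  induction K using Finset.induction_on with
  | empty => simp
  | insert a K ha ih =>
    rw [biUnion_insert, card_insert_of_notMem ha]
    have h1 := card_union_add_card_inter (N a) (K.biUnion N)
    have h2 : #(N a ∩ K.biUnion N) ≤ #K * 2 := by
      rw [inter_biUnion]
      exact card_biUnion_le_card_mul _ _ _ fun x hx => h.codeg _ _ fun hE => ha (hE ▸ hx)
    have h3 := h.deg a
    nlinarith

lemma CubeLike.reach_of_linked (h : CubeLike d N M) {K : Finset α} {v : α} (hv : v ∈ K)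
    (hK : Linked N K) : Reach (nbr2 N M) {v} K := by
  intro W hW hne
  by_cases hvW : v ∈ W
  · exact Or.inl ⟨v, hvW, mem_singleton_self v⟩
  · obtain ⟨x, hx, u, hu, hxu⟩ := hK W hW hne (fun hE => hvW (hE ▸ hv))
    exact Or.inr ⟨x, hx, u, hu, h.mem_nbr2.2 (by rwa [inter_comm])⟩

lemma CubeLike.four_mul_card_le (h : CubeLike d N M) (hd : 13 ≤ d) {K : Finset α}
    (hK : 8 * #(K.biUnion N) < d ^ 2) : 4 * #K ≤ d := by
  by_contra! hlt
  obtain ⟨L, hLK, hL⟩ := exists_subset_card_eq (show d / 4 ≤ #K by omega)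
  have h1 := h.le_card_biUnion L
  have h2 := card_le_card (biUnion_subset_biUnion_of_subset_left N hLK)
  rw [hL] at h1
  have h3 : d ≤ 4 * (d / 4) + 3 := by omega
  have h4 : 4 * (d / 4) ≤ d := by omega
  have h5 : 3 ≤ d / 4 := by omega
  generalize d / 4 = k at *
  nlinarith

lemma CubeLike.three_mul_le (h : CubeLike d N M) {K : Finset α} (hK : 4 * #K ≤ d) :
    3 * d * #K ≤ 4 * #(K.biUnion N) := by
  have h1 := h.le_card_biUnion K
  nlinarith

open Classical in
lemma CubeLike.sum_bigComps_small_le (h : CubeLike d N M) (hd : 13 ≤ d)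
    (hw : PolymerWeight d N C w) (hsmall : 3 * (d : ℝ) ^ 2 * Real.exp (-(51 / 100) * d) ≤ 1)
    (v : α) :
    ∑ K ∈ (bigComps N v).filter (fun K => 8 * #(K.biUnion N) < d ^ 2), act N w K ≤
      (3 * (d : ℝ) ^ 2 * Real.exp (-(51 / 100) * d)) ^ 2 * 3 := by
  set y := Real.exp (-(51 / 100) * d) with hy
  have hy0 : 0 < y := Real.exp_pos _
  have hd0 : (0 : ℝ) < d := by exact_mod_cast (by omega : 0 < d)
  have hreach := sum_reach_le_exp (nbr2 N M) (d ^ 2) (by positivity) h.card_nbr2_le {v}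
  have hexp : Real.exp ((#({v} : Finset α) : ℝ) / (d ^ 2 : ℕ)) ≤ 3 := by
    have : ((#({v} : Finset α) : ℝ) / (d ^ 2 : ℕ)) ≤ 1 := by
      rw [card_singleton, Nat.cast_one, div_le_one (by positivity)]
      exact_mod_cast Nat.one_le_pow _ _ (by omega)
    exact (Real.exp_le_exp.2 this).trans (by linarith [Real.exp_one_lt_d9])
  calc ∑ K ∈ (bigComps N v).filter (fun K => 8 * #(K.biUnion N) < d ^ 2), act N w K
      ≤ ∑ K ∈ (bigComps N v).filter (fun K => 8 * #(K.biUnion N) < d ^ 2),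
          (3 * (d : ℝ) ^ 2 * y) ^ 2 * (1 / (3 * (d ^ 2 : ℕ) : ℝ)) ^ #K := by
        refine sum_le_sum fun K hK => ?_
        simp only [bigComps, comps, mem_filter, mem_univ, true_and] at hK
        have h4 := h.four_mul_card_le hd hK.2
        have h3 := h.three_mul_le h4
        rw [act, hw.one K h4, one_mul]
        have e1 : ((1 : ℝ) / 2) ^ #(K.biUnion N) ≤ y ^ #K := by
          have h3' : 3 * (d : ℝ) * #K ≤ 4 * #(K.biUnion N) := by exact_mod_cast h3
          rw [hy, ← Real.exp_nat_mul, one_div, inv_pow, ← Real.exp_log (show (0 : ℝ) < 2 by norm_num),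
            ← Real.exp_nat_mul, ← Real.exp_neg]
          apply Real.exp_le_exp.2
          have hl := Real.log_two_gt_d9
          have hdK : 0 ≤ (d : ℝ) * #K := by positivity
          nlinarith
        have e2 : y ^ #K = (3 * (d : ℝ) ^ 2 * y) ^ #K * (1 / (3 * (d ^ 2 : ℕ) : ℝ)) ^ #K := by
          rw [← mul_pow]
          congr 1
          push_cast
          field_simp
        rw [e2] at e1
        refine e1.trans ?_
        gcongr ?_ * _
        exact pow_le_pow_of_le_one (by positivity) hsmall hK.1.2
    _ = (3 * (d : ℝ) ^ 2 * y) ^ 2 *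
          ∑ K ∈ (bigComps N v).filter (fun K => 8 * #(K.biUnion N) < d ^ 2),
            (1 / (3 * (d ^ 2 : ℕ) : ℝ)) ^ #K := by rw [mul_sum]
    _ ≤ (3 * (d : ℝ) ^ 2 * y) ^ 2 * 3 := by
        gcongr
        refine le_trans ?_ (hreach.trans hexp)
        apply sum_le_sum_of_subset_of_nonneg
        · intro K hK
          simp only [bigComps, comps, mem_filter, mem_univ, true_and] at hK ⊢
          exact h.reach_of_linked hK.1.1.1 hK.1.1.2.1
        · intro K _ _
          positivity

end

lemma eventually_comps_numeric (C : ℝ) : ∃ d₀ : ℕ, 13 ≤ d₀ ∧ ∀ d : ℕ, d₀ ≤ d →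
    3 * (d : ℝ) ^ 2 * Real.exp (-(51 / 100) * d) ≤ 1 ∧
    (3 * (d : ℝ) ^ 2 * Real.exp (-(51 / 100) * d)) ^ 2 * 3 +
      (2 ^ (d - 1) + 1) ^ 2 * (C * Real.exp (-3 * d)) ≤ Real.exp (-(4 / 5) * d) := by
  have h1 : ∀ᶠ d : ℕ in Filter.atTop, 54 * (d : ℝ) ^ 4 ≤ Real.exp (1 / 5 * d) := by
    have := (isLittleO_pow_exp_pos_mul_atTop 4 (show (0 : ℝ) < 1 / 5 by norm_num)).bound
      (show (0 : ℝ) < 1 / 54 by norm_num)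
    filter_upwards [tendsto_natCast_atTop_atTop.eventually this] with d hd
    rw [Real.norm_of_nonneg (by positivity), Real.norm_of_nonneg (by positivity)] at hd
    linarith
  have h2 : ∀ᶠ d : ℕ in Filter.atTop, 2 * C ≤ (d : ℝ) :=
    tendsto_natCast_atTop_atTop.eventually (Filter.eventually_ge_atTop _)
  obtain ⟨d₀, hd₀⟩ := Filter.eventually_atTop.1 (h1.and h2)
  refine ⟨max d₀ 13, le_max_right _ _, fun d hd => ?_⟩
  obtain ⟨h1, h2⟩ := hd₀ d ((le_max_left _ _).trans hd)
  have hd13 : 13 ≤ d := (le_max_right _ _).trans hd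
  have hd1 : (1 : ℝ) ≤ d := by exact_mod_cast (by omega : 1 ≤ d)
  have hA : 54 * (d : ℝ) ^ 4 * Real.exp (-(51 / 100) * d) ^ 2 ≤ Real.exp (-(82 / 100) * d) := by
    rw [← Real.exp_nat_mul]
    calc 54 * (d : ℝ) ^ 4 * Real.exp ((2 : ℕ) * (-(51 / 100) * d))
        ≤ Real.exp (1 / 5 * d) * Real.exp ((2 : ℕ) * (-(51 / 100) * d)) := by gcongr
      _ = Real.exp (-(82 / 100) * d) := by rw [← Real.exp_add]; congr 1; push_cast; ring
  have hmono : Real.exp (-(82 / 100) * d) ≤ Real.exp (-(4 / 5) * d) :=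
    Real.exp_le_exp.2 (by nlinarith)
  have hone : Real.exp (-(82 / 100) * d) ≤ 1 := Real.exp_le_one_iff.2 (by nlinarith)
  constructor
  · have : (3 * (d : ℝ) ^ 2 * Real.exp (-(51 / 100) * d)) ^ 2 ≤ 1 := by nlinarith
    exact (sq_le_one_iff₀ (by positivity)).1 this
  · have hB : (2 ^ (d - 1) + 1 : ℝ) ^ 2 ≤ Real.exp (7 / 5 * d) := by
      have e1 : (2 ^ (d - 1) + 1 : ℝ) ≤ 2 ^ d := by
        obtain ⟨k, rfl⟩ : ∃ k, d = k + 1 := ⟨d - 1, by omega⟩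
        have : (1 : ℝ) ≤ 2 ^ k := one_le_pow₀ (by norm_num)
        rw [Nat.add_sub_cancel, pow_succ]; linarith
      have e2 : (2 : ℝ) ^ d ≤ Real.exp (7 / 10 * d) := by
        calc (2 : ℝ) ^ d = Real.exp (Real.log 2) ^ d := by rw [Real.exp_log (by norm_num)]
          _ = Real.exp (d * Real.log 2) := (Real.exp_nat_mul _ _).symm
          _ ≤ _ := Real.exp_le_exp.2 (by nlinarith [Real.log_two_lt_d9])
      calc (2 ^ (d - 1) + 1 : ℝ) ^ 2 ≤ Real.exp (7 / 10 * d) ^ 2 := by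
            gcongr; exact e1.trans e2
        _ = Real.exp (7 / 5 * d) := by rw [← Real.exp_nat_mul]; congr 1; push_cast; ring
    have hC : C * (Real.exp (7 / 5 * d) * Real.exp (-3 * d)) ≤ 1 / 2 * Real.exp (-(4 / 5) * d) := by
      have e1 : Real.exp (7 / 5 * d) * Real.exp (-3 * d) =
          Real.exp (-(4 / 5) * d) * Real.exp (-(4 / 5) * d) := by
        rw [← Real.exp_add, ← Real.exp_add]; congr 1; ring
      have e2 : d * Real.exp (-(4 / 5) * d) ≤ 1 := by
        have e3 : (d : ℝ) ≤ Real.exp (4 / 5 * d) := by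
          have : (d : ℝ) ≤ 54 * (d : ℝ) ^ 4 := by
            have : (d : ℝ) * 1 ≤ d * (54 * (d : ℝ) ^ 3) := by
              gcongr
              nlinarith [one_le_pow₀ hd1 (n := 3)]
            linarith
          exact (this.trans h1).trans (Real.exp_le_exp.2 (by linarith))
        calc d * Real.exp (-(4 / 5) * d) ≤ Real.exp (4 / 5 * d) * Real.exp (-(4 / 5) * d) := by
              gcongr
          _ = 1 := by rw [← Real.exp_add]; simp
      have e4 := Real.exp_pos (-(4 / 5) * (d : ℝ))
      rw [e1]
      nlinarith
    have hB' : (2 ^ (d - 1) + 1) ^ 2 * (C * Real.exp (-3 * d)) ≤ 1 / 2 * Real.exp (-(4 / 5) * d) := by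
      rcases le_total 0 C with hC0 | hC0
      · calc (2 ^ (d - 1) + 1) ^ 2 * (C * Real.exp (-3 * d))
            ≤ Real.exp (7 / 5 * d) * (C * Real.exp (-3 * d)) := by gcongr
          _ ≤ _ := by linarith
      · have : (2 ^ (d - 1) + 1 : ℝ) ^ 2 * (C * Real.exp (-3 * d)) ≤ 0 :=
          mul_nonpos_of_nonneg_of_nonpos (by positivity)
            (mul_nonpos_of_nonpos_of_nonneg hC0 (Real.exp_pos _).le)
        linarith [Real.exp_pos (-(4 / 5) * (d : ℝ))]
    nlinarith

lemma exists_sum_bigComps_le (C : ℝ) : ∃ d₀ : ℕ, 13 ≤ d₀ ∧ ∀ d : ℕ, d₀ ≤ d →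
    ∀ {α β : Type} [Fintype α] [Fintype β] [DecidableEq α] [DecidableEq β]
    {N : α → Finset β} {M : β → Finset α}, CubeLike d N M → ∀ {w : Finset α → ℝ},
    PolymerWeight d N C w → ∀ v : α,
    ∑ K ∈ bigComps N v, act N w K ≤ Real.exp (-(4 / 5) * d) := by
  classical
  obtain ⟨d₁, -, hcont⟩ := exists_containers
  obtain ⟨d₂, hd₂, hnum⟩ := eventually_comps_numeric C
  refine ⟨max d₁ d₂, hd₂.trans (le_max_right _ _), ?_⟩
  intro d hd α β _ _ _ _ N M h w hw v
  obtain ⟨hnum1, hnum2⟩ := hnum d ((le_max_right _ _).trans hd)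
  refine le_trans ?_ hnum2
  have hd13 : 13 ≤ d := hd₂.trans ((le_max_right _ _).trans hd)
  rw [← sum_filter_add_sum_filter_not _ (fun K => 8 * #(K.biUnion N) < d ^ 2)]
  refine add_le_add (h.sum_bigComps_small_le hd13 hw hnum1 v) ?_
  set n := 2 ^ (d - 1) with hn
  set X := (bigComps N v).filter (fun K => ¬ 8 * #(K.biUnion N) < d ^ 2) with hX
  have hC0 : 0 ≤ C := by
    have := hw.sum_le ∅
    simp [hw.one ∅] at this
    linarith
  have hle : ∀ p : ℕ × ℕ,
      ∑ K ∈ X.filter (fun K => #(cl N K) = p.1 ∧ #(K.biUnion N) = p.2), act N w K ≤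
        C * Real.exp (-3 * d) := by
    intro ⟨a, g⟩
    have hrhs : 0 ≤ C * Real.exp (-3 * d) := by positivity
    by_cases hag : 2 * a ≤ Fintype.card α ∧ d ^ 2 ≤ 8 * g
    · obtain ⟨𝒞, hcov, hsum⟩ := hcont d ((le_max_left _ _).trans hd) h v a g hag.1 hag.2
      have hsub : X.filter (fun K => #(cl N K) = a ∧ #(K.biUnion N) = g) ⊆
          (𝒞.biUnion powerset).filter fun K => #(K.biUnion N) = g := by
        intro K hK
        simp only [hX, bigComps, comps, mem_filter, mem_univ, true_and] at hK
        obtain ⟨S, hS, hKS⟩ := hcov K hK.1.1.1.1 hK.1.1.1.2.1 hK.2.1 hK.2.2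
        exact mem_filter.2 ⟨mem_biUnion.2 ⟨S, hS, mem_powerset.2 hKS⟩, hK.2.2⟩
      calc _ ≤ ∑ K ∈ (𝒞.biUnion powerset).filter (fun K => #(K.biUnion N) = g), act N w K :=
            sum_le_sum_of_subset_of_nonneg hsub fun K _ _ => hw.act_nonneg K
        _ = ∑ K ∈ (𝒞.biUnion powerset).filter (fun K => #(K.biUnion N) = g),
              w K * (1 / 2) ^ g := by
            refine sum_congr rfl fun K hK => ?_
            rw [act, (mem_filter.1 hK).2]
        _ ≤ ∑ K ∈ 𝒞.biUnion powerset, w K * (1 / 2) ^ g :=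
            sum_le_sum_of_subset_of_nonneg (filter_subset _ _) fun K _ _ =>
              mul_nonneg (hw.nonneg K) (by positivity)
        _ ≤ ∑ S ∈ 𝒞, ∑ K ∈ S.powerset, w K * (1 / 2) ^ g :=
            sum_biUnion_le _ _ fun K => mul_nonneg (hw.nonneg K) (by positivity)
        _ ≤ ∑ S ∈ 𝒞, C * 2 ^ #S * (1 / 2) ^ g := by
            refine sum_le_sum fun S _ => ?_
            rw [← sum_mul]
            exact mul_le_mul_of_nonneg_right (hw.sum_le S) (by positivity)
        _ = (∑ S ∈ 𝒞, (2 : ℝ) ^ #S) * (C * (1 / 2) ^ g) := by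
            rw [sum_mul]
            exact sum_congr rfl fun S _ => by ring
        _ ≤ 2 ^ g * Real.exp (-3 * d) * (C * (1 / 2) ^ g) := by gcongr
        _ = C * Real.exp (-3 * d) * (2 * (1 / 2)) ^ g := by rw [mul_pow]; ring
        _ = _ := by norm_num
    · rw [sum_eq_zero]
      · exact hrhs
      · intro K hK
        exfalso
        simp only [hX, bigComps, comps, mem_filter, mem_univ, true_and] at hK
        apply hag
        rw [← hK.2.1, ← hK.2.2]
        exact ⟨hK.1.1.1.2.2, by omega⟩
  have hmaps : X ⊆ (range (n + 1) ×ˢ range (n + 1)).biUnion fun p =>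
      X.filter (fun K => #(cl N K) = p.1 ∧ #(K.biUnion N) = p.2) := by
    intro K hK
    refine mem_biUnion.2 ⟨(#(cl N K), #(K.biUnion N)), ?_, mem_filter.2 ⟨hK, rfl, rfl⟩⟩
    have h1 := card_le_univ (cl N K)
    have h2 := card_le_univ (K.biUnion N)
    rw [h.card_left] at h1
    rw [h.card_right] at h2
    simp only [mem_product, mem_range]
    omega
  calc ∑ K ∈ X, act N w K ≤ _ :=
        sum_le_sum_of_subset_of_nonneg hmaps fun K _ _ => hw.act_nonneg K
    _ ≤ _ := sum_biUnion_le _ _ hw.act_nonneg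
    _ ≤ ∑ p ∈ range (n + 1) ×ˢ range (n + 1), C * Real.exp (-3 * d) :=
        sum_le_sum fun p _ => hle p
    _ = _ := by
        rw [sum_const, card_product, card_range, nsmul_eq_mul, hn]
        push_cast
        ring

/-! ### The partition functions are bounded -/

lemma two_pow_le_exp (d : ℕ) : (2 : ℝ) ^ d ≤ Real.exp (7 / 10 * d) := by
  calc (2 : ℝ) ^ d = Real.exp (Real.log 2) ^ d := by rw [Real.exp_log (by norm_num)]
    _ = Real.exp (d * Real.log 2) := (Real.exp_nat_mul _ _).symm
    _ ≤ _ := Real.exp_le_exp.2 (by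
      have : (0 : ℝ) ≤ d := Nat.cast_nonneg d
      nlinarith [Real.log_two_lt_d9])

open Classical in
lemma exists_partition_le (C : ℝ) : ∃ d₀ : ℕ, 13 ≤ d₀ ∧ ∀ d : ℕ, d₀ ≤ d →
    ∀ {α β : Type} [Fintype α] [Fintype β] [DecidableEq α] [DecidableEq β]
    {N : α → Finset β} {M : β → Finset α}, CubeLike d N M → ∀ {w : Finset α → ℝ},
    PolymerWeight d N C w →
    ∑ T ∈ smalls N univ, act N w T ≤ 9 ∧
      ∑ T ∈ (smalls N univ).filter (Clustered N), act N w T ≤ 9 * Real.exp (-(1 / 10) * d) := by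
  obtain ⟨d₀, hd₀, hbig⟩ := exists_sum_bigComps_le C
  refine ⟨d₀, hd₀, ?_⟩
  intro d hd α β _ _ _ _ N M h w hw
  have hb := hbig d hd h hw
  have hd1 : 1 ≤ d := by omega
  set ζ := Real.exp (-(4 / 5) * d) with hζ
  have hcomps : ∀ v, ∑ K ∈ comps N v, act N w K ≤ (1 / 2) ^ d + ζ := by
    intro v
    rw [← sum_filter_add_sum_filter_not _ (fun K => 2 ≤ #K), add_comm]
    refine add_le_add ?_ (hb v)
    have hsub : (comps N v).filter (fun K => ¬ 2 ≤ #K) ⊆ {{v}} := by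
      intro K hK
      simp only [comps, mem_filter, mem_univ, true_and, mem_singleton] at hK ⊢
      exact (eq_singleton_iff_unique_mem.2 ⟨hK.1.1, fun x hx =>
        card_le_one.1 (by omega) x hx v hK.1.1⟩)
    refine (sum_le_sum_of_subset_of_nonneg hsub fun K _ _ => hw.act_nonneg K).trans ?_
    rw [sum_singleton, act, hw.one _ (by rw [card_singleton]; omega), singleton_biUnion, h.deg,
      one_mul]
  have hn : (2 : ℝ) ^ (d - 1) * ζ ≤ Real.exp (-(1 / 10) * d) := by
    calc (2 : ℝ) ^ (d - 1) * ζ ≤ 2 ^ d * ζ := by gcongr <;> [norm_num; omega]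
      _ ≤ Real.exp (7 / 10 * d) * ζ := by gcongr; exact two_pow_le_exp d
      _ = _ := by rw [hζ, ← Real.exp_add]; congr 1; ring
  have hn1 : Real.exp (-(1 / 10) * (d : ℝ)) ≤ 1 :=
    Real.exp_le_one_iff.2 (by nlinarith [Nat.cast_nonneg (α := ℝ) d])
  have hZ : ∑ T ∈ smalls N univ, act N w T ≤ 9 := by
    refine (hw.partition_le univ).trans ?_
    calc ∏ v : α, (1 + ∑ K ∈ comps N v, act N w K) ≤ ∏ v : α, Real.exp ((1 / 2) ^ d + ζ) := by
          refine prod_le_prod (fun v _ => ?_) fun v _ => ?_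
          · have := sum_nonneg fun K (_ : K ∈ comps N v) => hw.act_nonneg K
            linarith
          · rw [add_comm]
            exact (Real.add_one_le_exp _).trans (Real.exp_le_exp.2 (hcomps v))
      _ = Real.exp (2 ^ (d - 1) * ((1 / 2) ^ d + ζ)) := by
          rw [prod_const, card_univ, h.card_left, ← Real.exp_nat_mul]
          push_cast
          rfl
      _ ≤ Real.exp (1 + 1) := by
          apply Real.exp_le_exp.2
          have : (2 : ℝ) ^ (d - 1) * (1 / 2) ^ d ≤ 1 := by
            obtain ⟨k, rfl⟩ : ∃ k, d = k + 1 := ⟨d - 1, by omega⟩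
            rw [Nat.add_sub_cancel, pow_succ, ← mul_assoc, ← mul_pow]
            norm_num
          linarith
      _ ≤ 9 := by
          rw [Real.exp_add]
          nlinarith [Real.exp_one_lt_d9, Real.exp_pos 1]
  refine ⟨hZ, hw.clustered_le.trans ?_⟩
  have hsum : ∑ v, ∑ K ∈ bigComps N v, act N w K ≤ Real.exp (-(1 / 10) * d) := by
    calc ∑ v, ∑ K ∈ bigComps N v, act N w K ≤ ∑ v : α, ζ := sum_le_sum fun v _ => hb v
      _ = 2 ^ (d - 1) * ζ := by
        rw [sum_const, card_univ, h.card_left, nsmul_eq_mul]; push_cast; rfl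
      _ ≤ _ := hn
  have h0 := sum_nonneg fun K (_ : K ∈ smalls N univ) => hw.act_nonneg K
  calc _ ≤ Real.exp (-(1 / 10) * d) * 9 := by gcongr
    _ = _ := mul_comm _ _

section
variable {α β : Type*} [Fintype α] [Fintype β] [DecidableEq α] [DecidableEq β]
  {d : ℕ} {N : α → Finset β} {M : β → Finset α}

lemma polymerWeight_one (d : ℕ) (N : α → Finset β) : PolymerWeight d N 1 fun _ => 1 where
  nonneg _ := zero_le_one
  mul _ _ _ := by norm_num
  sum_le S := by simp
  one _ _ := rfl

lemma card_between (F G : Finset β) :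
    (#(univ.filter fun S => F ⊆ S ∧ Disjoint G S) : ℝ) =
      if Disjoint F G then 2 ^ Fintype.card β * ((1 / 2) ^ #F * (1 / 2) ^ #G) else 0 := by
  have hE : (univ.filter fun S => F ⊆ S ∧ Disjoint G S) = Icc F Gᶜ := by
    ext S
    simp only [mem_filter, mem_univ, true_and, mem_Icc, le_compl_iff_disjoint_left]
  rw [hE]
  split_ifs with h
  · have hsub : F ⊆ Gᶜ := le_compl_iff_disjoint_right.2 h
    have h1 := card_le_card hsub
    have h2 := card_compl_add_card G
    rw [card_Icc_finset hsub, Nat.cast_pow, Nat.cast_ofNat, ← h2,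
      ← Nat.sub_add_cancel h1, pow_add, pow_add, Nat.sub_add_cancel h1]
    have e : ∀ k : ℕ, (2 : ℝ) ^ k * (1 / 2) ^ k = 1 := fun k => by rw [← mul_pow]; norm_num
    calc (2 : ℝ) ^ (#Gᶜ - #F) = 2 ^ (#Gᶜ - #F) * (2 ^ #F * (1 / 2) ^ #F) *
          (2 ^ #G * (1 / 2) ^ #G) := by rw [e, e]; ring
      _ = _ := by ring
  · rw [Nat.cast_eq_zero, card_eq_zero, Icc_eq_empty_iff, le_compl_iff_disjoint_right]
    exact h

lemma card_disjoint (G : Finset β) :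
    (#(univ.filter fun S => Disjoint G S) : ℝ) = 2 ^ Fintype.card β * (1 / 2) ^ #G := by
  simpa using card_between ∅ G

lemma CubeLike.disjoint_biUnion (h : CubeLike d N M) {S : Finset β} {W : Finset α} :
    Disjoint (W.biUnion N) S ↔ Disjoint (S.biUnion M) W := by
  simp only [disjoint_left, mem_biUnion, forall_exists_index, and_imp]
  constructor
  · intro H a b hb hab ha
    exact H a ha ((h.mem_iff a b).2 hab) hb
  · intro H b a ha hab hb
    exact H b hb ((h.mem_iff a b).1 hab) ha

lemma CubeLike.card_le_card_biUnion (h : CubeLike d N M) (hd : 0 < d) (T : Finset α) :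
    #T ≤ #(T.biUnion N) := by
  apply Nat.le_of_mul_le_mul_left _ hd
  calc d * #T = ∑ a ∈ T, #(N a ∩ T.biUnion N) := by
        rw [sum_congr rfl fun a ha => by
          rw [inter_eq_left.2 (subset_biUnion_of_mem N ha), h.deg a], sum_const, smul_eq_mul,
          mul_comm]
    _ = ∑ b ∈ T.biUnion N, #(M b ∩ T) := h.sum_inter _ _
    _ ≤ ∑ b ∈ T.biUnion N, d := sum_le_sum fun b _ =>
        (card_le_card inter_subset_left).trans (h.deg' b).le
    _ = d * #(T.biUnion N) := by rw [sum_const, smul_eq_mul, mul_comm]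

lemma CubeLike.small_of_disjoint (h : CubeLike d N M) (hd : 0 < d) {S : Finset β} {W : Finset α}
    (hdis : Disjoint (W.biUnion N) S) (hW : ¬ Small N W) : Small M S := by
  rw [← biUnion_cl, h.disjoint_biUnion, ← biUnion_cl] at hdis
  have h1 := h.symm.card_le_card_biUnion hd (cl M S)
  have h2 := card_union_of_disjoint hdis
  have h3 := card_le_univ ((cl M S).biUnion M ∪ cl N W)
  have h4 := h.card_left
  have h5 := h.card_right
  unfold Small at hW ⊢
  omega

open Classical in
lemma CubeLike.total_le (h : CubeLike d N M) (hd : 0 < d)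
    (h1 : ∑ T ∈ smalls N univ, act N (fun _ => 1) T ≤ 9)
    (h2 : ∑ T ∈ smalls M univ, act M (fun _ => 1) T ≤ 9) :
    ∑ W : Finset α, (1 / 2 : ℝ) ^ #(W.biUnion N) ≤ 18 := by
  simp only [act, one_mul] at h1 h2
  rw [← sum_filter_add_sum_filter_not univ (Small N)]
  have h3 : ∑ W ∈ univ.filter (fun W => ¬ Small N W), (1 / 2 : ℝ) ^ #(W.biUnion N) ≤ 9 := by
    refine le_trans ?_ h2
    have hpos : (0 : ℝ) < 2 ^ 2 ^ (d - 1) := by positivity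
    refine le_of_mul_le_mul_left ?_ hpos
    rw [mul_sum, mul_sum]
    calc ∑ W ∈ univ.filter (fun W => ¬ Small N W), (2 : ℝ) ^ 2 ^ (d - 1) * (1 / 2) ^ #(W.biUnion N)
        = ∑ W ∈ univ.filter (fun W => ¬ Small N W), ∑ S : Finset β,
            if Disjoint (W.biUnion N) S then (1 : ℝ) else 0 := by
          refine sum_congr rfl fun W _ => ?_
          rw [← h.card_right, ← card_disjoint, sum_boole]
      _ = ∑ S : Finset β, ∑ W ∈ univ.filter (fun W => ¬ Small N W),
            if Disjoint (W.biUnion N) S then (1 : ℝ) else 0 := sum_comm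
      _ = ∑ S ∈ smalls M univ, ∑ W ∈ univ.filter (fun W => ¬ Small N W),
            if Disjoint (W.biUnion N) S then (1 : ℝ) else 0 := by
          symm
          apply sum_subset (subset_univ _)
          intro S _ hS
          refine sum_eq_zero fun W hW => if_neg fun hdis => hS ?_
          simp only [smalls, mem_filter, mem_powerset, subset_univ, true_and]
          exact h.small_of_disjoint hd hdis (mem_filter.1 hW).2
      _ ≤ ∑ S ∈ smalls M univ, ∑ W : Finset α, if Disjoint (S.biUnion M) W then (1 : ℝ) else 0 := by
          refine sum_le_sum fun S _ => ?_
          simp_rw [h.disjoint_biUnion]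
          exact sum_le_sum_of_subset_of_nonneg (filter_subset _ _) fun _ _ _ => by
            split_ifs <;> norm_num
      _ = _ := by
          refine sum_congr rfl fun S _ => ?_
          rw [sum_boole, card_disjoint, h.card_left]
  have h4 : ∑ W ∈ univ.filter (Small N), (1 / 2 : ℝ) ^ #(W.biUnion N) ≤ 9 := by
    simpa [smalls] using h1
  linarith

/-- The weight counting the subsets of the interior. -/
lemma CubeLike.polymerWeight_interior (h : CubeLike d N M) (hd : 0 < d) {C : ℝ}
    (hC : ∑ Q : Finset β, (1 / 2 : ℝ) ^ #(Q.biUnion M) ≤ C) :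
    PolymerWeight d N C fun T => 2 ^ #(interior M T) where
  nonneg _ := by positivity
  mul K T hdis := by
    rw [← pow_add]
    congr 1
    have hd' : Disjoint (interior M K) (interior M T) := by
      rw [disjoint_left]
      intro b hb hb'
      simp only [interior, mem_filter, mem_univ, true_and] at hb hb'
      obtain ⟨a, ha⟩ := card_pos.1 (by rw [h.deg' b]; exact hd)
      exact disjoint_left.1 hdis (mem_biUnion.2 ⟨a, hb ha, (h.mem_iff a b).2 ha⟩)
        (mem_biUnion.2 ⟨a, hb' ha, (h.mem_iff a b).2 ha⟩)
    rw [← card_union_of_disjoint hd']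
    congr 1
    ext b
    simp only [interior, mem_filter, mem_univ, true_and, mem_union]
    refine ⟨fun hb => ?_, fun hb => hb.elim (fun H => H.trans subset_union_left)
      fun H => H.trans subset_union_right⟩
    by_contra! hcon
    obtain ⟨a, ha, haK⟩ := not_subset.1 hcon.1
    obtain ⟨a', ha', haT⟩ := not_subset.1 hcon.2
    exact disjoint_left.1 hdis
      (mem_biUnion.2 ⟨a', (mem_union.1 (hb ha')).resolve_right haT, (h.mem_iff a' b).2 ha'⟩)
      (mem_biUnion.2 ⟨a, (mem_union.1 (hb ha)).resolve_left haK, (h.mem_iff a b).2 ha⟩)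
  sum_le S := by
    have hsub : ∀ (Q : Finset β) (U : Finset α), Q ⊆ interior M U ↔ Q.biUnion M ⊆ U := by
      intro Q U
      simp only [biUnion_subset, subset_iff (s₁ := Q), interior, mem_filter, mem_univ, true_and]
    calc ∑ U ∈ S.powerset, (2 : ℝ) ^ #(interior M U)
        = ∑ U ∈ S.powerset, ∑ Q : Finset β, if Q.biUnion M ⊆ U then (1 : ℝ) else 0 := by
          refine sum_congr rfl fun U _ => ?_
          rw [sum_boole]
          simp_rw [← hsub]
          rw [show (univ.filter fun Q => Q ⊆ interior M U) = (interior M U).powerset by ext; simp,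
            card_powerset]
          simp
      _ = ∑ Q : Finset β, ∑ U ∈ S.powerset, if Q.biUnion M ⊆ U then (1 : ℝ) else 0 := sum_comm
      _ ≤ ∑ Q : Finset β, (1 / 2 : ℝ) ^ #(Q.biUnion M) * 2 ^ #S := by
          refine sum_le_sum fun Q _ => ?_
          rw [sum_boole, show (S.powerset.filter fun U => Q.biUnion M ⊆ U) = Icc (Q.biUnion M) S by
            ext U; simp [and_comm]]
          by_cases hQ : Q.biUnion M ⊆ S
          · rw [card_Icc_finset hQ]
            have h1 := card_le_card hQ
            rw [← Nat.sub_add_cancel h1, pow_add, Nat.sub_add_cancel h1, mul_left_comm, ← mul_pow]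
            norm_num
          · rw [Icc_eq_empty_iff.2 hQ]
            simp
      _ ≤ C * 2 ^ #S := by
          rw [← sum_mul]
          gcongr
  one K hK := by
    have : interior M K = ∅ := by
      rw [interior, filter_eq_empty_iff]
      intro b _ hb
      have := card_le_card hb
      rw [h.deg' b] at this
      omega
    simp [this]

end

/-! ### Counting triples -/

section
variable {α β : Type*} [Fintype α] [Fintype β] [DecidableEq α] [DecidableEq β]
  {d : ℕ} {N : α → Finset β} {M : β → Finset α}

/-- Triples `(S, P, Q)` with `P`, `Q` nonempty, all neighbours of `P` in `S` and none of `Q`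
in `S`. -/
def triples (N : α → Finset β) : Finset (Finset β × Finset α × Finset α) :=
  univ.filter fun p => p.2.1.Nonempty ∧ p.2.2.Nonempty ∧ p.2.1.biUnion N ⊆ p.1 ∧
    Disjoint (p.2.2.biUnion N) p.1

/-- The triples with `P ∈ A` and `Q ∈ B`. -/
def triplesOn (N : α → Finset β) (A B : Finset (Finset α)) :
    Finset (Finset β × Finset α × Finset α) :=
  univ.filter fun p => p.2.1 ∈ A ∧ p.2.2 ∈ B ∧ p.2.1.biUnion N ⊆ p.1 ∧
    Disjoint (p.2.2.biUnion N) p.1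

lemma card_triplesOn (N : α → Finset β) (A B : Finset (Finset α)) :
    (#(triplesOn N A B) : ℝ) = ∑ P ∈ A, ∑ Q ∈ B,
      if Disjoint (P.biUnion N) (Q.biUnion N) then 2 ^ Fintype.card β *
        ((1 / 2) ^ #(P.biUnion N) * (1 / 2) ^ #(Q.biUnion N)) else 0 := by
  have hmaps : Set.MapsTo (fun p : Finset β × Finset α × Finset α => p.2)
      (triplesOn N A B : Set (Finset β × Finset α × Finset α))
      (A ×ˢ B : Finset (Finset α × Finset α)) := by
    intro p hp
    simp only [triplesOn, coe_filter, mem_univ, true_and, Set.mem_ofPred_eq] at hp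
    simp [hp.1, hp.2.1]
  rw [card_eq_sum_card_fiberwise hmaps, sum_product, Nat.cast_sum]
  refine sum_congr rfl fun P hP => ?_
  rw [Nat.cast_sum]
  refine sum_congr rfl fun Q hQ => ?_
  rw [← card_between]
  congr 1
  refine card_nbij' (fun p => p.1) (fun S => (S, P, Q)) ?_ ?_ ?_ ?_
  · rintro ⟨S, P', Q'⟩ hp
    simp only [triplesOn, coe_filter, mem_filter, mem_univ, true_and, Set.mem_ofPred_eq,
      Prod.mk.injEq] at hp ⊢
    obtain ⟨hp, rfl, rfl⟩ := hp
    exact hp.2.2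
  · intro S hS
    simp only [triplesOn, coe_filter, mem_filter, mem_univ, true_and, Set.mem_ofPred_eq] at hS ⊢
    exact ⟨⟨hP, hQ, hS⟩, trivial⟩
  · rintro ⟨S, P', Q'⟩ hp
    simp only [coe_filter, Set.mem_ofPred_eq, Prod.mk.injEq] at hp
    simp [hp.2.1, hp.2.2]
  · intro S _
    rfl

lemma card_triplesOn_le (N : α → Finset β) (A B : Finset (Finset α)) :
    (#(triplesOn N A B) : ℝ) ≤ 2 ^ Fintype.card β *
      ((∑ P ∈ A, (1 / 2) ^ #(P.biUnion N)) * ∑ Q ∈ B, (1 / 2) ^ #(Q.biUnion N)) := by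
  rw [card_triplesOn, sum_mul_sum, mul_sum]
  refine sum_le_sum fun P _ => ?_
  rw [mul_sum]
  refine sum_le_sum fun Q _ => ?_
  split_ifs
  · exact le_rfl
  · positivity

open Classical in
/-- Triples `(U, P, Q)` with `P` large, `Q` nonempty, no neighbours of `P` in `U` and all of `Q`
in `U`. -/
noncomputable def largeTriples (N : α → Finset β) : Finset (Finset β × Finset α × Finset α) :=
  univ.filter fun p => ¬ Small N p.2.1 ∧ p.2.2.Nonempty ∧ Disjoint (p.2.1.biUnion N) p.1 ∧
    p.2.2.biUnion N ⊆ p.1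

open Classical in
lemma CubeLike.card_largeTriples_le (h : CubeLike d N M) (hd : 2 ≤ d) :
    (#(largeTriples N) : ℝ) ≤ 2 ^ Fintype.card α *
      ∑ U ∈ (smalls M univ).filter (Clustered M), act M (fun U => 2 ^ #(interior N U)) U := by
  have hmaps : Set.MapsTo (fun p : Finset β × Finset α × Finset α => p.1)
      (largeTriples N : Set (Finset β × Finset α × Finset α))
      ((smalls M univ).filter (Clustered M) : Finset (Finset β)) := by
    intro p hp
    simp only [largeTriples, coe_filter, mem_univ, true_and, Set.mem_ofPred_eq] at hp
    simp only [smalls, coe_filter, mem_filter, mem_powerset, subset_univ, true_and,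
      Set.mem_ofPred_eq]
    refine ⟨h.small_of_disjoint (by omega) hp.2.2.1 hp.1, ?_⟩
    obtain ⟨q, hq⟩ := hp.2.1
    have h1 : 1 < #(N q) := by rw [h.deg]; omega
    obtain ⟨a, ha, b, hb, hab⟩ := one_lt_card.1 h1
    have hsub := (subset_biUnion_of_mem N hq).trans hp.2.2.2
    exact ⟨a, hsub ha, b, hsub hb, hab.symm,
      q, mem_inter.2 ⟨(h.mem_iff _ _).1 ha, (h.mem_iff _ _).1 hb⟩⟩
  rw [card_eq_sum_card_fiberwise hmaps, Nat.cast_sum, mul_sum]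
  refine sum_le_sum fun U _ => ?_
  have hle : #((largeTriples N).filter fun p => p.1 = U) ≤
      #((univ.filter fun P => Disjoint (U.biUnion M) P) ×ˢ (interior N U).powerset) := by
    apply card_le_card_of_injOn (fun p => p.2)
    · rintro ⟨S, P, Q⟩ hp
      simp only [largeTriples, coe_filter, mem_filter, mem_univ, true_and, Set.mem_ofPred_eq] at hp
      obtain ⟨⟨-, -, hP, hQ⟩, rfl⟩ := hp
      simp only [coe_product, Set.mem_prod, coe_filter, mem_univ, true_and, Set.mem_ofPred_eq,
        coe_powerset, Set.mem_preimage, Set.mem_powerset_iff, coe_subset]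
      refine ⟨h.disjoint_biUnion.1 hP, fun q hq => ?_⟩
      simp only [interior, mem_filter, mem_univ, true_and]
      exact (subset_biUnion_of_mem N hq).trans hQ
    · rintro ⟨S, P⟩ hp ⟨S', P'⟩ hp' hE
      simp only [coe_filter, Set.mem_ofPred_eq] at hp hp' hE
      rw [hp.2, hp'.2, hE]
  calc (#((largeTriples N).filter fun p => p.1 = U) : ℝ)
      ≤ #((univ.filter fun P => Disjoint (U.biUnion M) P) ×ˢ (interior N U).powerset) := by
        exact_mod_cast hle
    _ = 2 ^ Fintype.card α * act M (fun U => 2 ^ #(interior N U)) U := by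
        rw [card_product, Nat.cast_mul, card_disjoint, card_powerset, act]
        push_cast
        ring

lemma card_biUnion_of_not_clustered (hdeg : ∀ a, #(N a) = d) {T : Finset α}
    (hT : ¬ Clustered N T) : #(T.biUnion N) = d * #T := by
  rw [card_biUnion, sum_congr rfl fun a _ => hdeg a, sum_const, smul_eq_mul, mul_comm]
  intro v hv u hu huv
  by_contra hdis
  rw [Function.onFun, disjoint_iff_inter_eq_empty, ← not_nonempty_iff_eq_empty, not_not] at hdis
  exact hT ⟨v, hv, u, hu, huv.symm, hdis⟩

lemma sum_pow_card_nonempty (x : ℝ) :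
    ∑ P ∈ univ.filter (fun P : Finset α => P.Nonempty), x ^ #P = (1 + x) ^ Fintype.card α - 1 := by
  have h1 := sum_pow_mul_eq_add_pow x 1 (univ : Finset α)
  simp only [one_pow, mul_one, powerset_univ, card_univ] at h1
  rw [add_comm, ← h1, ← sum_filter_add_sum_filter_not univ (fun P : Finset α => P.Nonempty)]
  have : univ.filter (fun P : Finset α => ¬ P.Nonempty) = {∅} := by
    ext P; simp
  rw [this]
  simp

lemma sum_pow_card_mem_le {x : ℝ} (hx : 0 ≤ x) (v : α) :
    ∑ P ∈ univ.filter (fun P : Finset α => v ∈ P), x ^ #P ≤ x * (1 + x) ^ Fintype.card α := by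
  have h1 := sum_pow_mul_eq_add_pow x 1 (univ : Finset α)
  simp only [one_pow, mul_one, powerset_univ, card_univ] at h1
  rw [add_comm, ← h1, mul_sum]
  have hinj : Set.InjOn (fun P : Finset α => P.erase v)
      (univ.filter (fun P : Finset α => v ∈ P) : Finset (Finset α)) := by
    intro P hP Q hQ hE
    simp only [coe_filter, mem_univ, true_and, Set.mem_ofPred_eq] at hP hQ hE
    rw [← insert_erase hP, ← insert_erase hQ, hE]
  calc ∑ P ∈ univ.filter (fun P : Finset α => v ∈ P), x ^ #P
      = ∑ P ∈ univ.filter (fun P : Finset α => v ∈ P), x * x ^ #(P.erase v) := by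
        refine sum_congr rfl fun P hP => ?_
        rw [← pow_succ', card_erase_add_one (mem_filter.1 hP).2]
    _ = ∑ P ∈ (univ.filter (fun P : Finset α => v ∈ P)).image (fun P => P.erase v), x * x ^ #P :=
        (sum_image (f := fun P : Finset α => x * x ^ #P) hinj).symm
    _ ≤ _ := sum_le_sum_of_subset_of_nonneg (subset_univ _) fun _ _ _ => by positivity

lemma CubeLike.sum_not_disjoint_le (h : CubeLike d N M) {x : ℝ} (hx : 0 ≤ x) :
    ∑ p ∈ univ.filter (fun p : Finset α × Finset α =>
      ¬ Disjoint (p.1.biUnion N) (p.2.biUnion N)), x ^ #p.1 * x ^ #p.2 ≤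
      Fintype.card α * d ^ 2 * (x * (1 + x) ^ Fintype.card α) ^ 2 := by
  have hsub : univ.filter (fun p : Finset α × Finset α =>
      ¬ Disjoint (p.1.biUnion N) (p.2.biUnion N)) ⊆
      (univ : Finset α).biUnion fun u => (nbr2 N M u).biUnion fun v =>
        univ.filter (fun P : Finset α => u ∈ P) ×ˢ univ.filter (fun Q : Finset α => v ∈ Q) := by
    intro p hp
    rw [mem_filter, not_disjoint_iff] at hp
    obtain ⟨-, b, hb, hb'⟩ := hp
    obtain ⟨u, hu, hbu⟩ := mem_biUnion.1 hb
    obtain ⟨v, hv, hbv⟩ := mem_biUnion.1 hb'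
    simp only [mem_biUnion, mem_product, mem_filter, mem_univ, true_and]
    exact ⟨u, v, h.mem_nbr2.2 ⟨b, mem_inter.2 ⟨hbu, hbv⟩⟩, hu, hv⟩
  have hpos : ∀ p : Finset α × Finset α, 0 ≤ x ^ #p.1 * x ^ #p.2 := fun p => by positivity
  set y := x * (1 + x) ^ Fintype.card α with hy
  have hy0 : 0 ≤ y := by positivity
  calc _ ≤ _ := sum_le_sum_of_subset_of_nonneg hsub fun p _ _ => hpos p
    _ ≤ _ := sum_biUnion_le _ _ hpos
    _ ≤ ∑ u : α, (d : ℝ) ^ 2 * y ^ 2 := by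
        refine sum_le_sum fun u _ => (sum_biUnion_le _ _ hpos).trans ?_
        calc _ ≤ ∑ v ∈ nbr2 N M u, y ^ 2 := by
              refine sum_le_sum fun v _ => ?_
              rw [sum_product]
              dsimp only
              rw [← sum_mul_sum, sq]
              exact mul_le_mul (sum_pow_card_mem_le hx u) (sum_pow_card_mem_le hx v)
                (sum_nonneg fun _ _ => by positivity) hy0
          _ ≤ _ := by
              rw [sum_const, nsmul_eq_mul]
              gcongr
              exact_mod_cast h.card_nbr2_le u
    _ = _ := by rw [sum_const, card_univ, nsmul_eq_mul]; ring

lemma CubeLike.le_card_triples (h : CubeLike d N M) :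
    (2 : ℝ) ^ Fintype.card β * (((1 + (1 / 2) ^ d) ^ Fintype.card α - 1) ^ 2 -
      Fintype.card α * d ^ 2 * ((1 / 2) ^ d * (1 + (1 / 2) ^ d) ^ Fintype.card α) ^ 2) ≤
      #(triples N) := by
  set x : ℝ := (1 / 2) ^ d with hx
  have hx0 : 0 ≤ x := by positivity
  set A := univ.filter (fun P : Finset α => P.Nonempty) with hA
  have hE : triples N = triplesOn N A A := by
    ext p; simp [triples, triplesOn, hA]
  rw [hE, card_triplesOn, ← sum_pow_card_nonempty]
  have h1 : ∀ P Q : Finset α,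
      (2 : ℝ) ^ Fintype.card β * (x ^ #P * x ^ #Q -
        if Disjoint (P.biUnion N) (Q.biUnion N) then 0 else x ^ #P * x ^ #Q) ≤
      if Disjoint (P.biUnion N) (Q.biUnion N) then 2 ^ Fintype.card β *
        ((1 / 2) ^ #(P.biUnion N) * (1 / 2) ^ #(Q.biUnion N)) else 0 := by
    intro P Q
    have hP : ∀ P : Finset α, x ^ #P ≤ (1 / 2 : ℝ) ^ #(P.biUnion N) := fun P => by
      rw [hx, ← pow_mul]
      exact pow_le_pow_of_le_one (by norm_num) (by norm_num) (h.card_biUnion_le P)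
    split_ifs
    · rw [sub_zero]
      gcongr
      · exact hP P
      · exact hP Q
    · simp
  refine le_trans ?_ (sum_le_sum fun P _ => sum_le_sum fun Q _ => h1 P Q)
  simp_rw [← mul_sum, sum_sub_distrib]
  rw [sq (∑ P ∈ A, x ^ #P), sum_mul_sum]
  gcongr
  refine le_trans ?_ (h.sum_not_disjoint_le hx0)
  rw [← sum_product', sum_filter]
  refine le_trans (sum_le_sum_of_subset_of_nonneg (subset_univ _) fun p _ _ => ?_) ?_
  · split_ifs <;> positivity
  · refine sum_le_sum fun p _ => ?_
    split_ifs <;> simp_all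

open Classical in
lemma CubeLike.card_triples_le (h : CubeLike d N M) (hd : 2 ≤ d) {Z E E' : ℝ}
    (hZ : ∑ T ∈ smalls N univ, act N (fun _ => 1) T ≤ Z)
    (hE : ∑ T ∈ (smalls N univ).filter (Clustered N), act N (fun _ => 1) T ≤ E)
    (hE' : ∑ U ∈ (smalls M univ).filter (Clustered M),
      act M (fun U => 2 ^ #(interior N U)) U ≤ E') :
    (#(triples N) : ℝ) ≤ 2 ^ Fintype.card β *
      (((1 + (1 / 2) ^ d) ^ Fintype.card α - 1) ^ 2 + 2 * (E * Z) + 2 * E') := by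
  set A := univ.filter (fun P : Finset α => P.Nonempty ∧ ¬ Clustered N P) with hA
  set B := smalls N (univ : Finset α) with hB
  set D := B.filter (Clustered N) with hD
  simp only [act, one_mul] at hZ hE
  have hcover : triples N ⊆ ((triplesOn N A A ∪ triplesOn N D B) ∪ triplesOn N B D) ∪
      (largeTriples N).image (fun p => (p.1ᶜ, p.2.1, p.2.2)) ∪
      (largeTriples N).image (fun p => (p.1, p.2.2, p.2.1)) := by
    rintro ⟨S, P, Q⟩ hp
    simp only [triples, mem_filter, mem_univ, true_and] at hp
    obtain ⟨hP, hQ, hPS, hQS⟩ := hp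
    simp only [mem_union, mem_image]
    by_cases hPs : Small N P
    · by_cases hQs : Small N Q
      · left; left
        have hPB : P ∈ B := by simp [hB, smalls, hPs]
        have hQB : Q ∈ B := by simp [hB, smalls, hQs]
        by_cases hPc : Clustered N P
        · left; right
          simp only [triplesOn, mem_filter, mem_univ, true_and]
          exact ⟨mem_filter.2 ⟨hPB, hPc⟩, hQB, hPS, hQS⟩
        · by_cases hQc : Clustered N Q
          · right
            simp only [triplesOn, mem_filter, mem_univ, true_and]
            exact ⟨hPB, mem_filter.2 ⟨hQB, hQc⟩, hPS, hQS⟩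
          · left; left
            simp only [triplesOn, mem_filter, mem_univ, true_and]
            exact ⟨by simp [hA, hP, hPc], by simp [hA, hQ, hQc], hPS, hQS⟩
      · right
        refine ⟨(S, Q, P), ?_, rfl⟩
        simp only [largeTriples, mem_filter, mem_univ, true_and]
        exact ⟨hQs, hP, hQS, hPS⟩
    · left; right
      refine ⟨(Sᶜ, P, Q), ?_, by simp⟩
      simp only [largeTriples, mem_filter, mem_univ, true_and]
      refine ⟨hPs, hQ, ?_, subset_compl_iff_disjoint_right.2 hQS⟩
      exact subset_compl_iff_disjoint_right.1 (by simpa using hPS)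
  have hcard : (#(triples N) : ℝ) ≤ #(triplesOn N A A) + #(triplesOn N D B) +
      #(triplesOn N B D) + #(largeTriples N) + #(largeTriples N) := by
    have := card_le_card hcover
    have u1 := card_union_le (((triplesOn N A A ∪ triplesOn N D B) ∪ triplesOn N B D) ∪
      (largeTriples N).image (fun p => (p.1ᶜ, p.2.1, p.2.2)))
      ((largeTriples N).image (fun p => (p.1, p.2.2, p.2.1)))
    have u2 := card_union_le ((triplesOn N A A ∪ triplesOn N D B) ∪ triplesOn N B D)
      ((largeTriples N).image (fun p => (p.1ᶜ, p.2.1, p.2.2)))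
    have u3 := card_union_le (triplesOn N A A ∪ triplesOn N D B) (triplesOn N B D)
    have u4 := card_union_le (triplesOn N A A) (triplesOn N D B)
    have i1 := card_image_le (s := largeTriples N) (f := fun p => (p.1ᶜ, p.2.1, p.2.2))
    have i2 := card_image_le (s := largeTriples N) (f := fun p => (p.1, p.2.2, p.2.1))
    exact_mod_cast (by omega : #(triples N) ≤ #(triplesOn N A A) + #(triplesOn N D B) +
      #(triplesOn N B D) + #(largeTriples N) + #(largeTriples N))
  have hlarge := h.card_largeTriples_le hd
  rw [show Fintype.card α = Fintype.card β by rw [h.card_left, h.card_right]] at hlarge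
  have hAsum : ∑ P ∈ A, (1 / 2 : ℝ) ^ #(P.biUnion N) ≤
      (1 + (1 / 2) ^ d) ^ Fintype.card α - 1 := by
    rw [← sum_pow_card_nonempty]
    calc ∑ P ∈ A, (1 / 2 : ℝ) ^ #(P.biUnion N) = ∑ P ∈ A, ((1 / 2 : ℝ) ^ d) ^ #P := by
          refine sum_congr rfl fun P hP => ?_
          rw [card_biUnion_of_not_clustered h.deg (mem_filter.1 hP).2.2, pow_mul]
      _ ≤ _ := by
          apply sum_le_sum_of_subset_of_nonneg
          · intro P hP
            exact mem_filter.2 ⟨mem_univ _, (mem_filter.1 hP).2.1⟩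
          · intro _ _ _
            positivity
  have hpos : ∀ X : Finset (Finset α), 0 ≤ ∑ P ∈ X, (1 / 2 : ℝ) ^ #(P.biUnion N) := fun X =>
    sum_nonneg fun _ _ => by positivity
  have hE0 := (hpos _).trans hE
  have c1 := card_triplesOn_le N A A
  have c2 := card_triplesOn_le N D B
  have c3 := card_triplesOn_le N B D
  have m1 := mul_le_mul hAsum hAsum (hpos _) ((hpos _).trans hAsum)
  have m2 := mul_le_mul hE hZ (hpos _) hE0
  set t : ℝ := 2 ^ Fintype.card β
  have ht : 0 ≤ t := by positivity
  have k1 := mul_le_mul_of_nonneg_left m1 ht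
  have k2 := mul_le_mul_of_nonneg_left m2 ht
  have k3 := mul_le_mul_of_nonneg_left hE' ht
  have c3' : (#(triplesOn N B D) : ℝ) ≤ t * (E * Z) := by
    rw [mul_comm (∑ P ∈ B, _)] at c3
    exact c3.trans k2
  have e1 : t * (((1 + (1 / 2) ^ d) ^ Fintype.card α - 1) ^ 2 + 2 * (E * Z) + 2 * E') =
    t * (((1 + (1 / 2) ^ d) ^ Fintype.card α - 1) * ((1 + (1 / 2) ^ d) ^ Fintype.card α - 1)) +
    2 * (t * (E * Z)) + 2 * (t * E') := by ring
  rw [e1]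
  linarith [c1.trans k1, c2.trans k2, hlarge.trans k3]

end

lemma exists_card_triples : ∃ d₀ : ℕ, 13 ≤ d₀ ∧ ∀ d : ℕ, d₀ ≤ d →
    ∀ {α β : Type} [Fintype α] [Fintype β] [DecidableEq α] [DecidableEq β]
    {N : α → Finset β} {M : β → Finset α}, CubeLike d N M →
    |(#(triples N) : ℝ) - (√(Real.exp 1) - 1) ^ 2 * 2 ^ 2 ^ (d - 1)| ≤
      1 / 2 * Real.exp (-(1 / 20) * d) * 2 ^ 2 ^ (d - 1) := by
  obtain ⟨d₁, hd₁, hone⟩ := exists_partition_le 1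
  obtain ⟨d₂, -, hInt⟩ := exists_partition_le 18
  have hev : ∀ᶠ d : ℕ in Filter.atTop, 360 * (d : ℝ) ^ 2 ≤ Real.exp (1 / 20 * d) := by
    have := (isLittleO_pow_exp_pos_mul_atTop 2 (show (0 : ℝ) < 1 / 20 by norm_num)).bound
      (show (0 : ℝ) < 1 / 360 by norm_num)
    filter_upwards [tendsto_natCast_atTop_atTop.eventually this] with d hd
    rw [Real.norm_of_nonneg (by positivity), Real.norm_of_nonneg (by positivity)] at hd
    linarith
  obtain ⟨d₃, hd₃⟩ := Filter.eventually_atTop.1 hev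
  refine ⟨max d₁ (max d₂ d₃), hd₁.trans (le_max_left _ _), ?_⟩
  intro d hd α β _ _ _ _ N M h
  rw [max_le_iff, max_le_iff] at hd
  have hd13 : 13 ≤ d := hd₁.trans hd.1
  have hlarge := hd₃ d hd.2.2
  obtain ⟨hZ, hE⟩ := hone d hd.1 h (polymerWeight_one d N)
  obtain ⟨hZ', -⟩ := hone d hd.1 h.symm (polymerWeight_one d M)
  have htot := h.total_le (by omega) hZ hZ'
  obtain ⟨-, hE'⟩ := hInt d hd.2.1 h.symm (h.symm.polymerWeight_interior (by omega) htot)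
  have hup := h.card_triples_le (by omega) hZ hE hE'
  have hlow := h.le_card_triples
  rw [h.card_left, h.card_right] at hup hlow
  set x : ℝ := (1 / 2) ^ d with hx
  set B : ℝ := (1 + x) ^ 2 ^ (d - 1) with hB
  set s := √(Real.exp 1) with hs
  have hx0 : 0 < x := by positivity
  have hnx : ((2 ^ (d - 1) : ℕ) : ℝ) * x = 1 / 2 := by
    obtain ⟨k, rfl⟩ : ∃ k, d = k + 1 := ⟨d - 1, by omega⟩
    rw [hx, Nat.add_sub_cancel, pow_succ, ← mul_assoc, Nat.cast_pow, Nat.cast_ofNat, ← mul_pow]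
    norm_num
  have hsexp : Real.exp (1 / 2) = s := by rw [hs, ← Real.exp_half]
  have hs2 : s ≤ 2 := by
    rw [hs, Real.sqrt_le_left (by norm_num)]
    linarith [Real.exp_one_lt_d9]
  have hBs : B ≤ s := by
    rw [← hsexp, ← hnx, Real.exp_nat_mul, hB]
    gcongr
    rw [add_comm]
    exact Real.add_one_le_exp x
  have hB1 : 1 ≤ B := one_le_pow₀ (by linarith)
  have hsB : s - x ≤ B := by
    have h1 : Real.exp (x - x ^ 2) ≤ 1 + x := by
      rw [← Real.le_log_iff_exp_le (by linarith)]
      refine le_trans ?_ (Real.one_sub_inv_le_log_of_pos (by linarith))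
      rw [← sub_nonneg]
      have : 1 - (1 + x)⁻¹ - (x - x ^ 2) = x ^ 3 / (1 + x) := by field_simp; ring
      rw [this]
      positivity
    have h2 : Real.exp (1 / 2 + -(x / 2)) ≤ B := by
      calc Real.exp (1 / 2 + -(x / 2)) = Real.exp ((2 ^ (d - 1) : ℕ) * (x - x ^ 2)) := by
            congr 1
            linear_combination (-1 + x) * hnx
        _ = Real.exp (x - x ^ 2) ^ 2 ^ (d - 1) := Real.exp_nat_mul _ _
        _ ≤ B := by rw [hB]; gcongr
    rw [Real.exp_add, hsexp] at h2
    have h3 := Real.add_one_le_exp (-(x / 2))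
    have h4 : 1 ≤ s := hB1.trans hBs
    nlinarith
  have hxe : x ≤ Real.exp (-(1 / 2) * d) := by
    rw [mul_comm, Real.exp_nat_mul, hx]
    gcongr
    linarith [Real.add_one_le_exp (-(1 / 2) : ℝ)]
  set e := Real.exp (-(1 / 20) * d) with he
  have he0 : 0 < e := Real.exp_pos _
  have hd1 : (1 : ℝ) ≤ (d : ℝ) ^ 2 := one_le_pow₀ (by exact_mod_cast (by omega : 1 ≤ d))
  have hE10 : (d : ℝ) ^ 2 * Real.exp (-(1 / 10) * d) ≤ 1 / 360 * e := by
    calc (d : ℝ) ^ 2 * Real.exp (-(1 / 10) * d)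
        ≤ (1 / 360 * Real.exp (1 / 20 * d)) * Real.exp (-(1 / 10) * d) := by
          gcongr; linarith
      _ = 1 / 360 * e := by rw [mul_assoc, ← Real.exp_add, he]; congr 2; ring
  have hE10' : Real.exp (-(1 / 10) * d) ≤ 1 / 360 * e := by
    refine le_trans ?_ hE10
    nlinarith [Real.exp_pos (-(1 / 10) * (d : ℝ))]
  have hxd : (d : ℝ) ^ 2 * x ≤ 1 / 360 * e := by
    refine le_trans ?_ hE10
    gcongr
    refine hxe.trans (Real.exp_le_exp.2 ?_)
    nlinarith [Nat.cast_nonneg (α := ℝ) d]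
  have hxe' : x ≤ 1 / 360 * e := by nlinarith
  have hbad : ((2 ^ (d - 1) : ℕ) : ℝ) * d ^ 2 * (x * B) ^ 2 ≤ 2 * (d ^ 2 * x) := by
    calc ((2 ^ (d - 1) : ℕ) : ℝ) * d ^ 2 * (x * B) ^ 2
        = ((2 ^ (d - 1) : ℕ) * x) * (d ^ 2 * x) * B ^ 2 := by ring
      _ ≤ 1 / 2 * (d ^ 2 * x) * 2 ^ 2 := by
          rw [hnx]; gcongr; exact hBs.trans hs2
      _ = _ := by ring
  have hsq1 : (B - 1) ^ 2 ≤ (s - 1) ^ 2 :=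
    pow_le_pow_left₀ (by linarith) (by linarith) 2
  have hsq2 : (s - 1) ^ 2 - 2 * x ≤ (B - 1) ^ 2 := by
    have h1 : (s - B) * (s + B - 2) ≤ x * 2 :=
      mul_le_mul (by linarith) (by linarith) (by linarith) hx0.le
    linarith
  have hfin1 : (s - 1) ^ 2 - 1 / 2 * e ≤
      (B - 1) ^ 2 - ((2 ^ (d - 1) : ℕ) : ℝ) * d ^ 2 * (x * B) ^ 2 := by linarith
  have hfin2 : (B - 1) ^ 2 + 2 * (9 * Real.exp (-(1 / 10) * d) * 9) +
      2 * (9 * Real.exp (-(1 / 10) * d)) ≤ (s - 1) ^ 2 + 1 / 2 * e := by linarith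
  have hpos : (0 : ℝ) ≤ 2 ^ 2 ^ (d - 1) := by positivity
  have hm1 := (mul_le_mul_of_nonneg_left hfin1 hpos).trans hlow
  have hm2 := hup.trans (mul_le_mul_of_nonneg_left hfin2 hpos)
  rw [abs_le]
  constructor <;> linarith

/-! ### The parity classes of the cube -/

/-- The vertex obtained from `v` by changing coordinate `i`. -/
def flip {d : ℕ} (i : Fin d) (v : Fin d → Bool) : Fin d → Bool := Function.update v i (!v i)

/-- The parity of the number of coordinates of `v` that are `true`. -/
def par : {d : ℕ} → (Fin d → Bool) → Bool
  | 0, _ => false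
  | _ + 1, v => xor (v 0) (par (Fin.tail v))

section
variable {d : ℕ}

lemma flip_same (i : Fin d) (v : Fin d → Bool) : flip i v i = !v i := by simp [flip]

lemma flip_of_ne {i j : Fin d} (h : j ≠ i) (v : Fin d → Bool) : flip i v j = v j := by
  simp [flip, h]

lemma flip_flip (i : Fin d) (v : Fin d → Bool) : flip i (flip i v) = v := by
  ext j
  by_cases h : j = i
  · subst h; simp [flip_same]
  · simp [flip_of_ne h]

lemma flip_injective (v : Fin d → Bool) : Function.Injective fun i => flip i v := by
  intro i j h
  by_contra hij
  have := congrFun h i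
  simp [flip_same, flip_of_ne hij] at this

lemma flip_zero_cons (b : Bool) (v : Fin d → Bool) :
    flip 0 (Fin.cons b v : Fin (d + 1) → Bool) = Fin.cons (!b) v := by
  ext j
  refine Fin.cases ?_ (fun j => ?_) j
  · simp [flip_same]
  · simp [flip_of_ne (Fin.succ_ne_zero j)]

lemma flip_succ_cons (b : Bool) (i : Fin d) (v : Fin d → Bool) :
    flip i.succ (Fin.cons b v : Fin (d + 1) → Bool) = Fin.cons b (flip i v) := by
  ext j
  refine Fin.cases ?_ (fun j => ?_) j
  · simp [flip_of_ne (Fin.succ_ne_zero i).symm]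
  · by_cases h : j = i
    · subst h; simp [flip_same]
    · rw [flip_of_ne (fun hE => h (Fin.succ_injective _ hE)), Fin.cons_succ, Fin.cons_succ,
        flip_of_ne h]

lemma par_cons (b : Bool) (v : Fin d → Bool) :
    par (Fin.cons b v : Fin (d + 1) → Bool) = xor b (par v) := by
  simp [par]

lemma par_flip : ∀ {d : ℕ} (i : Fin d) (v : Fin d → Bool), par (flip i v) = !par v
  | 0, i, _ => i.elim0
  | d + 1, i, v => by
    rw [← Fin.cons_self_tail v]
    refine Fin.cases ?_ (fun j => ?_) i
    · rw [flip_zero_cons, par_cons, par_cons]; simp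
    · rw [flip_succ_cons, par_cons, par_cons, par_flip j]; simp

lemma card_par_eq (d : ℕ) (p : Bool) :
    #(univ.filter fun v : Fin (d + 1) → Bool => par v = p) = 2 ^ d := by
  have : #(univ : Finset (Fin d → Bool)) = 2 ^ d := by simp
  rw [← this]
  refine card_nbij' (fun v => Fin.tail v) (fun v => Fin.cons (xor p (par v)) v) ?_ ?_ ?_ ?_
  · intro v _; simp
  · intro v _
    simp [par_cons]
  · intro v hv
    simp only [coe_filter, mem_univ, true_and, Set.mem_ofPred_eq] at hv
    rw [← hv]
    conv_rhs => rw [← Fin.cons_self_tail v]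
    simp [par]
  · intro v _
    simp

/-! ### Vertex isoperimetry -/

/-- The neighbourhood of a set of vertices. -/
def nbhd (T : Finset (Fin d → Bool)) : Finset (Fin d → Bool) :=
  T.biUnion fun v => univ.image fun i => flip i v

lemma mem_nbhd {T : Finset (Fin d → Bool)} {u : Fin d → Bool} :
    u ∈ nbhd T ↔ ∃ v ∈ T, ∃ i, flip i v = u := by
  simp [nbhd]

/-- The section of `T` with first coordinate `b`. -/
def sect (T : Finset (Fin (d + 1) → Bool)) (b : Bool) : Finset (Fin d → Bool) :=
  univ.filter fun v => (Fin.cons b v : Fin (d + 1) → Bool) ∈ T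

lemma mem_sect {T : Finset (Fin (d + 1) → Bool)} {b : Bool} {v : Fin d → Bool} :
    v ∈ sect T b ↔ (Fin.cons b v : Fin (d + 1) → Bool) ∈ T := by
  simp [sect]

lemma card_sect (T : Finset (Fin (d + 1) → Bool)) : #T = #(sect T false) + #(sect T true) := by
  have h : ∀ b, #(sect T b) = #(T.filter fun v => v 0 = b) := by
    intro b
    refine card_nbij' (fun v => Fin.cons b v) (fun v => Fin.tail v) ?_ ?_ ?_ ?_
    · intro v hv
      simp only [mem_coe, mem_sect, coe_filter, Set.mem_ofPred_eq] at hv ⊢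
      exact ⟨hv, rfl⟩
    · intro v hv
      simp only [coe_filter, Set.mem_ofPred_eq, mem_coe, mem_sect] at hv ⊢
      rw [← hv.2, Fin.cons_self_tail]
      exact hv.1
    · intro v _; simp
    · intro v hv
      simp only [coe_filter, Set.mem_ofPred_eq] at hv
      rw [← hv.2]
      exact Fin.cons_self_tail v
  rw [h, h, ← card_filter_add_card_filter_not (s := T) (fun v => v 0 = false)]
  congr 2
  ext v
  simp

lemma sect_subset_sect_nbhd (T : Finset (Fin (d + 1) → Bool)) (b : Bool) :
    sect T (!b) ⊆ sect (nbhd T) b := by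
  intro v hv
  rw [mem_sect] at hv ⊢
  refine mem_nbhd.2 ⟨_, hv, 0, ?_⟩
  rw [flip_zero_cons, Bool.not_not]

lemma nbhd_sect_subset (T : Finset (Fin (d + 1) → Bool)) (b : Bool) :
    nbhd (sect T b) ⊆ sect (nbhd T) b := by
  intro v hv
  obtain ⟨u, hu, i, rfl⟩ := mem_nbhd.1 hv
  rw [mem_sect] at hu ⊢
  exact mem_nbhd.2 ⟨_, hu, i.succ, flip_succ_cons _ _ _⟩

lemma profile_step_close {c c' x y : ℝ} (hc0 : 0 ≤ c) (hc1 : c ≤ 1)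
    (hcc : c ^ 3 / 8 ≤ c - c') (hy : 0 ≤ y) (hyx : y ≤ x) (hx : x ≤ 1)
    (h : x ≤ y + c * (y * (1 - y))) :
    (x + y) / 2 + c' * ((x + y) / 2 * (1 - (x + y) / 2)) ≤
      ((x + c * (x * (1 - x))) + (y + c * (y * (1 - y)))) / 2 := by
  obtain ⟨δ, hδ⟩ : ∃ δ, δ = (x - y) / 2 := ⟨_, rfl⟩
  obtain ⟨z, hz⟩ : ∃ z, z = (x + y) / 2 := ⟨_, rfl⟩
  obtain ⟨j, hj⟩ : ∃ j, j = y * (1 - y) := ⟨_, rfl⟩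
  obtain ⟨J, hJ⟩ : ∃ J, J = z * (1 - z) := ⟨_, rfl⟩
  have hδ0 : 0 ≤ δ := by linarith
  have hj0 : 0 ≤ j := by rw [hj]; exact mul_nonneg hy (by linarith)
  have hj4 : j ≤ 1 / 4 := by rw [hj]; nlinarith [sq_nonneg (y - 1 / 2)]
  have hδj : δ ≤ c * j / 2 := by rw [hj]; linarith
  have hJj : j / 2 ≤ J := by
    have h1 : J = j + δ * (1 - y - z) := by rw [hJ, hj, hδ, hz]; ring
    have h2 : -δ ≤ δ * (1 - y - z) := by
      have : 0 ≤ δ * (2 - y - z) := mul_nonneg hδ0 (by linarith)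
      linarith
    have h3 : c * j ≤ j := by nlinarith
    linarith
  have hδ2 : δ ^ 2 ≤ c ^ 2 / 8 * J := by
    calc δ ^ 2 ≤ (c * j / 2) ^ 2 := pow_le_pow_left₀ hδ0 hδj 2
      _ = c ^ 2 / 4 * (j * j) := by ring
      _ ≤ c ^ 2 / 4 * (1 / 4 * j) := by gcongr
      _ = c ^ 2 / 8 * (j / 2) := by ring
      _ ≤ c ^ 2 / 8 * J := by gcongr
  have hJ0 : 0 ≤ J := by linarith
  have h1 : c * δ ^ 2 ≤ (c - c') * J := by
    calc c * δ ^ 2 ≤ c * (c ^ 2 / 8 * J) := by gcongr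
      _ = c ^ 3 / 8 * J := by ring
      _ ≤ (c - c') * J := by gcongr
  have h2 : ((x + c * (x * (1 - x))) + (y + c * (y * (1 - y)))) / 2 = z + c * (J - δ ^ 2) := by
    rw [hJ, hz, hδ]; ring
  rw [h2, ← hz, ← hJ]
  linarith

lemma profile_step {c c' x y A B : ℝ} (hc'0 : 0 ≤ c') (hc1 : c ≤ 1)
    (hcc : c ^ 3 / 8 ≤ c - c') (hc0 : 0 ≤ c) (hy : 0 ≤ y) (hyx : y ≤ x) (hx : x ≤ 1)
    (hA : x + c * (x * (1 - x)) ≤ A) (hB : y + c * (y * (1 - y)) ≤ B) (hBx : x ≤ B) :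
    (x + y) / 2 + c' * ((x + y) / 2 * (1 - (x + y) / 2)) ≤ (A + B) / 2 := by
  by_cases h : x ≤ y + c * (y * (1 - y))
  · exact (profile_step_close hc0 hc1 hcc hy hyx hx h).trans (by linarith)
  · push Not at h
    have hcont : ContinuousOn (fun y : ℝ => y + c * (y * (1 - y))) (Set.Icc y x) := by fun_prop
    have hmem : x ∈ Set.Icc (y + c * (y * (1 - y))) (x + c * (x * (1 - x))) :=
      ⟨h.le, by nlinarith [mul_nonneg hc0 (mul_nonneg (hy.trans hyx) (sub_nonneg.2 hx))]⟩
    obtain ⟨y₀, ⟨hy₀, hy₀x⟩, hE⟩ := intermediate_value_Icc hyx hcont hmem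
    dsimp only at hE
    have h1 := profile_step_close hc0 hc1 hcc (hy.trans hy₀) hy₀x hx hE.ge
    rw [hE] at h1
    have hc'1 : c' ≤ 1 := by
      have : 0 ≤ c ^ 3 := by positivity
      linarith
    have h2 : (x + y) / 2 + c' * ((x + y) / 2 * (1 - (x + y) / 2)) ≤
        (x + y₀) / 2 + c' * ((x + y₀) / 2 * (1 - (x + y₀) / 2)) := by
      have h3 : 0 ≤ (y₀ - y) / 2 * (1 + c' * (1 - (x + y₀) / 2 - (x + y) / 2)) := by
        apply mul_nonneg (by linarith)
        have : 0 ≤ c' * (2 - (x + y₀) / 2 - (x + y) / 2) := mul_nonneg hc'0 (by linarith)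
        linarith
      have h4 : (x + y₀) / 2 + c' * ((x + y₀) / 2 * (1 - (x + y₀) / 2)) -
          ((x + y) / 2 + c' * ((x + y) / 2 * (1 - (x + y) / 2))) =
          (y₀ - y) / 2 * (1 + c' * (1 - (x + y₀) / 2 - (x + y) / 2)) := by ring
      linarith
    linarith

lemma inv_sqrt_step {d : ℕ} (hd : 1 ≤ d) :
    (1 / √(d : ℝ)) ^ 3 / 8 ≤ 1 / √(d : ℝ) - 1 / √((d + 1 : ℕ) : ℝ) := by
  have hd' : (1 : ℝ) ≤ d := by exact_mod_cast hd
  obtain ⟨a, ha⟩ : ∃ a, a = √(d : ℝ) := ⟨_, rfl⟩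
  obtain ⟨b, hb⟩ : ∃ b, b = √((d + 1 : ℕ) : ℝ) := ⟨_, rfl⟩
  have ha2 : a ^ 2 = d := by rw [ha]; exact Real.sq_sqrt (by linarith)
  have hb2 : b ^ 2 = d + 1 := by rw [hb, Real.sq_sqrt (by positivity)]; push_cast; rfl
  have ha1 : 1 ≤ a := by rw [ha]; exact Real.one_le_sqrt.2 hd'
  have hb0 : 0 < b := by rw [hb]; positivity
  rw [← ha, ← hb]
  have hb2a : b ≤ 2 * a := by nlinarith
  have hba : 1 = (b - a) * (b + a) := by linarith
  have hab : 0 < b - a := by nlinarith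
  have h1 : 1 / a - 1 / b = (b - a) / (a * b) := by field_simp
  have h2 : (1 / a) ^ 3 / 8 = 1 / (8 * a ^ 3) := by field_simp
  rw [h1, h2, div_le_div_iff₀ (by positivity) (by positivity)]
  have h3 : b * (b + a) ≤ 8 * a ^ 2 := by nlinarith
  calc 1 * (a * b) = (b - a) * (b + a) * (a * b) := by rw [← hba]
    _ = (b - a) * (a * (b * (b + a))) := by ring
    _ ≤ (b - a) * (a * (8 * a ^ 2)) := by gcongr
    _ = (b - a) * (8 * a ^ 3) := by ring

lemma isoperimetry : ∀ d : ℕ, 1 ≤ d → ∀ (p : Bool) (T : Finset (Fin d → Bool)),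
    (∀ v ∈ T, par v = p) →
    (#T : ℝ) / 2 ^ (d - 1) + 1 / √d * ((#T : ℝ) / 2 ^ (d - 1) * (1 - (#T : ℝ) / 2 ^ (d - 1))) ≤
      (#(nbhd T) : ℝ) / 2 ^ (d - 1) := by
  have hcard : ∀ (d : ℕ) (p : Bool) (T : Finset (Fin (d + 1) → Bool)), (∀ v ∈ T, par v = p) →
      #T ≤ 2 ^ d := by
    intro d p T hT
    rw [← card_par_eq d p]
    exact card_le_card fun v hv => by simp [hT v hv]
  intro d hd
  induction d, hd using Nat.le_induction with
  | base =>
    intro p T hT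
    have h1 := hcard 0 p T hT
    rcases T.eq_empty_or_nonempty with rfl | ⟨v, hv⟩
    · simp
    · have h2 : #T = 1 := le_antisymm h1 (card_pos.2 ⟨v, hv⟩)
      have h3 : 1 ≤ #(nbhd T) := card_pos.2 ⟨_, mem_nbhd.2 ⟨v, hv, 0, rfl⟩⟩
      have h3' : (1 : ℝ) ≤ #(nbhd T) := by exact_mod_cast h3
      simpa [h2] using h3'
  | succ d hd ih =>
    intro p T hT
    have hpar : ∀ b, ∀ v ∈ sect T b, par v = xor b p := by
      intro b v hv
      rw [mem_sect] at hv
      rw [← hT _ hv, par_cons]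
      simp
    obtain ⟨k, rfl⟩ : ∃ k, d = k + 1 := ⟨d - 1, by omega⟩
    simp only [Nat.add_sub_cancel] at ih ⊢
    have hn : (0 : ℝ) < 2 ^ k := by positivity
    have hle1 : ∀ b, (#(sect T b) : ℝ) / 2 ^ k ≤ 1 := by
      intro b
      rw [div_le_one hn]
      exact_mod_cast hcard k _ _ (hpar b)
    have hge0 : ∀ b, 0 ≤ (#(sect T b) : ℝ) / 2 ^ k := fun b => by positivity
    have hA : ∀ b, (#(sect T b) : ℝ) / 2 ^ k +
        1 / √((k + 1 : ℕ) : ℝ) * ((#(sect T b) : ℝ) / 2 ^ k * (1 - (#(sect T b) : ℝ) / 2 ^ k)) ≤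
        (#(sect (nbhd T) b) : ℝ) / 2 ^ k := by
      intro b
      refine (ih _ _ (hpar b)).trans ?_
      gcongr
      exact nbhd_sect_subset T b
    have hB : ∀ b, (#(sect T (!b)) : ℝ) / 2 ^ k ≤ (#(sect (nbhd T) b) : ℝ) / 2 ^ k := by
      intro b
      gcongr
      exact sect_subset_sect_nbhd T b
    have hc1 : 1 / √((k + 1 : ℕ) : ℝ) ≤ 1 := by
      rw [div_le_one (by positivity)]
      exact Real.one_le_sqrt.2 (by push_cast; linarith [Nat.cast_nonneg (α := ℝ) k])
    have hcc := inv_sqrt_step hd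
    have e1 : (#T : ℝ) / 2 ^ (k + 1) =
        ((#(sect T true) : ℝ) / 2 ^ k + (#(sect T false) : ℝ) / 2 ^ k) / 2 := by
      rw [card_sect T, pow_succ]
      push_cast
      field_simp
      ring
    have e2 : (#(nbhd T) : ℝ) / 2 ^ (k + 1) =
        ((#(sect (nbhd T) true) : ℝ) / 2 ^ k + (#(sect (nbhd T) false) : ℝ) / 2 ^ k) / 2 := by
      rw [card_sect (nbhd T), pow_succ]
      push_cast
      field_simp
      ring
    rw [e1, e2]
    rcases le_total ((#(sect T false) : ℝ) / 2 ^ k) ((#(sect T true) : ℝ) / 2 ^ k) with h | h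
    · exact profile_step (by positivity) hc1 hcc (by positivity) (hge0 _) h (hle1 _) (hA _) (hA _)
        (hB false)
    · rw [add_comm ((#(sect T true) : ℝ) / 2 ^ k), add_comm ((#(sect (nbhd T) true) : ℝ) / 2 ^ k)]
      exact profile_step (by positivity) hc1 hcc (by positivity) (hge0 _) h (hle1 _) (hA _) (hA _)
        (hB true)

end

/-! ### The cube as a bipartite graph -/

/-- The vertices of parity `p`. -/
abbrev Cls (d : ℕ) (p : Bool) : Type := {v : Fin d → Bool // par v = p}

/-- The neighbours of a vertex among those of parity `q`. -/
def nbCls {d : ℕ} (p q : Bool) (v : Cls d p) : Finset (Cls d q) :=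
  univ.filter fun u => ∃ i, flip i v.1 = u.1

section
variable {d : ℕ} {p q : Bool}

lemma mem_nbCls {v : Cls d p} {u : Cls d q} : u ∈ nbCls p q v ↔ ∃ i, flip i v.1 = u.1 := by
  simp [nbCls]

lemma mem_nbCls_comm {v : Cls d p} {u : Cls d q} : u ∈ nbCls p q v ↔ v ∈ nbCls q p u := by
  rw [mem_nbCls, mem_nbCls]
  constructor <;> rintro ⟨i, hi⟩ <;> exact ⟨i, by rw [← hi, flip_flip]⟩

lemma par_flip_of_ne (hpq : p ≠ q) (v : Cls d p) (i : Fin d) : par (flip i v.1) = q := by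
  rw [par_flip, v.2]
  revert hpq
  cases p <;> cases q <;> simp

lemma card_nbCls (hpq : p ≠ q) (v : Cls d p) : #(nbCls p q v) = d := by
  have : nbCls p q v = univ.image fun i => (⟨flip i v.1, par_flip_of_ne hpq v i⟩ : Cls d q) := by
    ext u
    simp [mem_nbCls, Subtype.ext_iff]
  rw [this, card_image_of_injective, card_univ, Fintype.card_fin]
  intro i j h
  exact flip_injective v.1 (Subtype.ext_iff.1 h)

lemma card_nbCls_inter (v w : Cls d p) (hvw : v ≠ w) : #(nbCls p q v ∩ nbCls p q w) ≤ 2 := by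
  rcases (nbCls p q v ∩ nbCls p q w).eq_empty_or_nonempty with h | ⟨u, hu⟩
  · simp [h]
  · rw [mem_inter, mem_nbCls, mem_nbCls] at hu
    obtain ⟨⟨i, hi⟩, j, hj⟩ := hu
    have hij : flip i v.1 = flip j w.1 := hi.trans hj.symm
    have hdiff : ∀ k, v.1 k ≠ w.1 k → k = i ∨ k = j := by
      intro k hk
      by_contra! hne
      apply hk
      rw [← flip_of_ne hne.1 v.1, hij, flip_of_ne hne.2]
    have hsub : (nbCls p q v ∩ nbCls p q w).image Subtype.val ⊆ {flip i v.1, flip j v.1} := by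
      intro x hx
      obtain ⟨y, hy, rfl⟩ := mem_image.1 hx
      rw [mem_inter, mem_nbCls, mem_nbCls] at hy
      obtain ⟨⟨k, hk⟩, l, hl⟩ := hy
      have hkl : flip k v.1 = flip l w.1 := hk.trans hl.symm
      have hkne : v.1 k ≠ w.1 k := by
        intro hE
        have hlk : l = k := by
          by_contra hne
          have := congrFun hkl k
          rw [flip_same, flip_of_ne (Ne.symm hne), hE] at this
          simp at this
        rw [hlk] at hkl
        apply hvw
        rw [Subtype.ext_iff, ← flip_flip k v.1, hkl, flip_flip]
      rw [← hk]
      rcases hdiff k hkne with rfl | rfl <;> simp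
    rw [← card_image_of_injective _ Subtype.val_injective]
    exact (card_le_card hsub).trans card_le_two

lemma image_biUnion_nbCls (hpq : p ≠ q) (T : Finset (Cls d p)) :
    (T.biUnion (nbCls p q)).image Subtype.val = nbhd (T.image Subtype.val) := by
  ext u
  simp only [mem_image, mem_biUnion, mem_nbCls, mem_nbhd]
  constructor
  · rintro ⟨y, ⟨v, hv, i, hi⟩, rfl⟩
    exact ⟨v.1, ⟨v, hv, rfl⟩, i, hi⟩
  · rintro ⟨_, ⟨v, hv, rfl⟩, i, hi⟩
    exact ⟨⟨u, hi ▸ par_flip_of_ne hpq v i⟩, ⟨v, hv, i, hi⟩, rfl⟩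

lemma card_cls (hd : 1 ≤ d) (p : Bool) : Fintype.card (Cls d p) = 2 ^ (d - 1) := by
  obtain ⟨k, rfl⟩ : ∃ k, d = k + 1 := ⟨d - 1, by omega⟩
  rw [Fintype.card_subtype, card_par_eq]
  rfl

lemma card_le_biUnion_nbCls (hd : 1 ≤ d) (hpq : p ≠ q) (T : Finset (Cls d p))
    (hT : 2 * #T ≤ Fintype.card (Cls d p)) :
    (#T : ℝ) ≤ 2 * √d * ((#(T.biUnion (nbCls p q)) : ℝ) - #T) := by
  have h := isoperimetry d hd p (T.image Subtype.val) (by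
    intro v hv
    obtain ⟨y, _, rfl⟩ := mem_image.1 hv
    exact y.2)
  rw [← image_biUnion_nbCls hpq, card_image_of_injective _ Subtype.val_injective,
    card_image_of_injective _ Subtype.val_injective] at h
  rw [card_cls hd] at hT
  have hT' : (2 : ℝ) * #T ≤ 2 ^ (d - 1) := by exact_mod_cast hT
  have hn : (0 : ℝ) < 2 ^ (d - 1) := by positivity
  have hs : 0 < √(d : ℝ) := Real.sqrt_pos.2 (by exact_mod_cast hd)
  have hx : (1 : ℝ) / 2 ≤ 1 - #T / 2 ^ (d - 1) := by
    have : (#T : ℝ) / 2 ^ (d - 1) ≤ 1 / 2 := by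
      rw [div_le_iff₀ hn]; linarith
    linarith
  have h1 : (#T : ℝ) / 2 ^ (d - 1) + 1 / √d * (#T / 2 ^ (d - 1) * (1 / 2)) ≤
      (#(T.biUnion (nbCls p q)) : ℝ) / 2 ^ (d - 1) := by
    refine le_trans ?_ h
    gcongr
  have h2 : (#T : ℝ) / 2 ^ (d - 1) + 1 / √d * (#T / 2 ^ (d - 1) * (1 / 2)) =
      (#T + #T / (2 * √d)) / 2 ^ (d - 1) := by field_simp
  rw [h2, div_le_div_iff_of_pos_right hn] at h1
  rw [← div_le_iff₀' (by positivity)]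
  linarith

lemma cubeLike_nbCls (hd : 1 ≤ d) (hpq : p ≠ q) : CubeLike d (nbCls (d := d) p q) (nbCls q p) where
  mem_iff _ _ := mem_nbCls_comm
  deg := card_nbCls hpq
  deg' := card_nbCls hpq.symm
  codeg := card_nbCls_inter
  codeg' := card_nbCls_inter
  iso := card_le_biUnion_nbCls hd hpq
  iso' := card_le_biUnion_nbCls hd hpq.symm
  card_left := card_cls hd p
  card_right := card_cls hd q

end

/-! ### Height functions with five values -/

section
variable {d : ℕ} {p : Bool}

lemma cubeAdj_iff (u v : Fin d → Bool) : cubeAdj d u v ↔ ∃ i, flip i u = v := by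
  rw [cubeAdj, card_eq_one]
  constructor
  · rintro ⟨i, hi⟩
    have h : ∀ j, u j ≠ v j ↔ j = i := by
      intro j
      simpa using congrArg (fun s => j ∈ s) hi
    refine ⟨i, funext fun j => ?_⟩
    by_cases hj : j = i
    · subst hj
      rw [flip_same]
      have := (h j).2 rfl
      revert this
      cases u j <;> cases v j <;> simp
    · rw [flip_of_ne hj]
      by_contra hne
      exact hj ((h j).1 hne)
  · rintro ⟨i, rfl⟩
    refine ⟨i, ?_⟩
    ext j
    by_cases hj : j = i
    · subst hj; simp [flip_same]
    · simp [flip_of_ne hj, hj]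

lemma forall_of_flip {W : (Fin d → Bool) → Prop} (hW : ∀ i v, W v → W (flip i v))
    {u : Fin d → Bool} (hu : W u) (v : Fin d → Bool) : W v := by
  have h : ∀ s : Finset (Fin d), W (s.piecewise v u) := by
    intro s
    induction s using Finset.induction_on with
    | empty => simpa using hu
    | insert j s hj ih =>
      rw [piecewise_insert]
      by_cases hE : v j = s.piecewise v u j
      · rw [hE, Function.update_eq_self]
        exact ih
      · have : v j = !s.piecewise v u j := by
          revert hE
          cases v j <;> cases s.piecewise v u j <;> simp
        rw [this]
        exact hW j _ ih
  simpa using h univ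

/-- The functions changing by exactly one along each edge of the cube. -/
def IsHeight (g : (Fin d → Bool) → ℤ) : Prop := ∀ i v, |g (flip i v) - g v| = 1

lemma IsHeight.cases {g : (Fin d → Bool) → ℤ} (hg : IsHeight g) (i : Fin d) (v : Fin d → Bool) :
    g (flip i v) = g v + 1 ∨ g (flip i v) = g v - 1 := by
  rcases (abs_eq zero_le_one).1 (hg i v) with h | h
  · left; omega
  · right; omega

lemma IsHeight.exists_eq {g : (Fin d → Bool) → ℤ} (hg : IsHeight g) {u v : Fin d → Bool} {m : ℤ}
    (hu : g u ≤ m) (hv : m ≤ g v) : ∃ w, g w = m := by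
  by_contra! hne
  have := forall_of_flip (W := fun w => g w < m) (fun i w hw => by
    have h1 := hne (flip i w)
    rcases hg.cases i w with h | h <;> omega) (lt_of_le_of_ne hu (hne u)) v
  omega

lemma IsHeight.exists_parity {g : (Fin d → Bool) → ℤ} (hg : IsHeight g) :
    ∃ p, ∀ v, Even (g v) ↔ par v = p := by
  have h : ∀ p, (Even (g fun _ => false) ↔ par (fun _ : Fin d => false) = p) →
      ∀ v, Even (g v) ↔ par v = p := by
    intro p hp v
    refine forall_of_flip (W := fun v => Even (g v) ↔ par v = p) (fun i v hv => ?_) hp v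
    have h1 : Even (g (flip i v)) ↔ ¬ Even (g v) := by
      rcases hg.cases i v with h | h <;> rw [h] <;> simp [parity_simps]
    rw [h1, hv, par_flip]
    cases par v <;> cases p <;> simp
  by_cases hE : Even (g fun _ => false)
  · exact ⟨_, h _ (iff_of_true hE rfl)⟩
  · exact ⟨!par (fun _ : Fin d => false), h _ (iff_of_false hE (by simp))⟩

lemma IsHeight.exists_range_eq {g : (Fin d → Bool) → ℤ} (hg : IsHeight g)
    (hcard : (Set.range g).ncard = 5) : ∃ m, Set.range g = Set.Icc (m - 2) (m + 2) := by
  obtain ⟨a, ha⟩ := Finite.exists_min g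
  obtain ⟨b, hb⟩ := Finite.exists_max g
  have hr : Set.range g = Set.Icc (g a) (g b) := by
    ext m
    constructor
    · rintro ⟨v, rfl⟩
      exact ⟨ha v, hb v⟩
    · rintro ⟨h1, h2⟩
      exact hg.exists_eq h1 h2
  refine ⟨g a + 2, ?_⟩
  rw [hr, ← coe_Icc, Set.ncard_coe_finset, Int.card_Icc] at hcard
  rw [hr]
  congr 1 <;> omega

/-- The height function encoded by a triple. -/
def height (p : Bool) (t : Finset (Cls d (!p)) × Finset (Cls d p) × Finset (Cls d p))
    (v : Fin d → Bool) : ℤ :=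
  if par v = p then
    if v ∈ t.2.1.image Subtype.val then 2 else if v ∈ t.2.2.image Subtype.val then -2 else 0
  else if v ∈ t.1.image Subtype.val then 1 else -1

/-- The triple of level sets of a height function. -/
def levels (p : Bool) (g : (Fin d → Bool) → ℤ) :
    Finset (Cls d (!p)) × Finset (Cls d p) × Finset (Cls d p) :=
  (univ.filter fun v => g v.1 = 1, univ.filter fun v => g v.1 = 2, univ.filter fun v => g v.1 = -2)

lemma even_height (p : Bool) (t : Finset (Cls d (!p)) × Finset (Cls d p) × Finset (Cls d p))
    (v : Fin d → Bool) : Even (height p t v) ↔ par v = p := by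
  unfold height
  split_ifs <;> simp_all [parity_simps]

lemma mem_triples {t : Finset (Cls d (!p)) × Finset (Cls d p) × Finset (Cls d p)} :
    t ∈ triples (nbCls p (!p)) ↔ t.2.1.Nonempty ∧ t.2.2.Nonempty ∧
      (∀ v ∈ t.2.1, ∀ u ∈ nbCls p (!p) v, u ∈ t.1) ∧
      ∀ v ∈ t.2.2, ∀ u ∈ nbCls p (!p) v, u ∉ t.1 := by
  simp only [triples, mem_filter, mem_univ, true_and, biUnion_subset, disjoint_biUnion_left]
  simp only [subset_iff, disjoint_left]

lemma ne_not (p : Bool) : p ≠ !p := by cases p <;> simp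

lemma disjoint_of_mem_triples (hd : 1 ≤ d)
    {t : Finset (Cls d (!p)) × Finset (Cls d p) × Finset (Cls d p)}
    (ht : t ∈ triples (nbCls p (!p))) {v : Cls d p} (hv : v ∈ t.2.1) : v ∉ t.2.2 := by
  intro hv'
  obtain ⟨-, -, h1, h2⟩ := mem_triples.1 ht
  obtain ⟨u, hu⟩ : (nbCls p (!p) v).Nonempty := by
    rw [← card_pos, card_nbCls (ne_not p)]
    exact hd
  exact h2 v hv' u hu (h1 v hv u hu)

lemma levels_height (hd : 1 ≤ d)
    {t : Finset (Cls d (!p)) × Finset (Cls d p) × Finset (Cls d p)}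
    (ht : t ∈ triples (nbCls p (!p))) : levels p (height p t) = t := by
  obtain ⟨S, P, Q⟩ := t
  have hPQ : ∀ v ∈ P, v ∉ Q := fun v hv => disjoint_of_mem_triples hd ht hv
  refine Prod.ext ?_ (Prod.ext ?_ ?_)
  · ext ⟨v, hv⟩
    simp [levels, height, hv]
  · ext ⟨v, hv⟩
    simp only [levels, height, hv, mem_filter, mem_univ, true_and, if_true, mem_image,
      Subtype.exists, exists_and_right, exists_eq_right, exists_true_left]
    split_ifs <;> simp_all
  · ext ⟨v, hv⟩
    have := hPQ ⟨v, hv⟩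
    simp only [levels, height, hv, mem_filter, mem_univ, true_and, if_true, mem_image,
      Subtype.exists, exists_and_right, exists_eq_right, exists_true_left]
    split_ifs <;> simp_all

lemma isHeight_height
    {t : Finset (Cls d (!p)) × Finset (Cls d p) × Finset (Cls d p)}
    (ht : t ∈ triples (nbCls p (!p))) : IsHeight (height p t) := by
  have key : ∀ i v, par v = p → |height p t (flip i v) - height p t v| = 1 := by
    intro i v hv
    have hv' : par (flip i v) = !p := by rw [par_flip, hv]
    obtain ⟨-, -, h1, h2⟩ := mem_triples.1 ht
    have h1' := fun h => h1 ⟨v, hv⟩ h ⟨flip i v, hv'⟩ (mem_nbCls.2 ⟨i, rfl⟩)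
    have h2' := fun h => h2 ⟨v, hv⟩ h ⟨flip i v, hv'⟩ (mem_nbCls.2 ⟨i, rfl⟩)
    simp only [height, hv, hv', mem_image, (ne_not p).symm, if_false, if_true,
      Subtype.exists, exists_and_right, exists_eq_right, exists_true_left]
    split_ifs <;> simp_all
  intro i v
  by_cases hv : par v = p
  · exact key i v hv
  · have := key i (flip i v) (by
      rw [par_flip]; revert hv; cases par v <;> cases p <;> simp)
    rwa [flip_flip, abs_sub_comm] at this

lemma range_height (hd : 1 ≤ d)
    {t : Finset (Cls d (!p)) × Finset (Cls d p) × Finset (Cls d p)}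
    (ht : t ∈ triples (nbCls p (!p))) : Set.range (height p t) = Set.Icc (-2) 2 := by
  obtain ⟨⟨a, ha⟩, ⟨b, hb⟩, -⟩ := mem_triples.1 ht
  have hl := levels_height hd ht
  have ha' : height p t a.1 = 2 := by
    rw [← hl] at ha
    simpa [levels] using ha
  have hb' : height p t b.1 = -2 := by
    rw [← hl] at hb
    simpa [levels] using hb
  ext m
  constructor
  · rintro ⟨v, rfl⟩
    unfold height
    split_ifs <;> simp
  · rintro ⟨h1, h2⟩
    exact (isHeight_height ht).exists_eq (hb'.le.trans h1) (h2.trans ha'.ge)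

lemma levels_mem_triples {g : (Fin d → Bool) → ℤ} (hg : IsHeight g)
    (hr : Set.range g = Set.Icc (-2) 2) (hp : ∀ v, Even (g v) ↔ par v = p) :
    levels p g ∈ triples (nbCls p (!p)) := by
  have hbd : ∀ v, -2 ≤ g v ∧ g v ≤ 2 := fun v => by
    have : g v ∈ Set.Icc (-2 : ℤ) 2 := hr ▸ Set.mem_range_self v
    exact this
  rw [mem_triples]
  refine ⟨?_, ?_, ?_, ?_⟩
  · obtain ⟨v, hv⟩ : (2 : ℤ) ∈ Set.range g := by rw [hr]; simp
    exact ⟨⟨v, (hp v).1 (by rw [hv]; decide)⟩, by simpa [levels] using hv⟩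
  · obtain ⟨v, hv⟩ : (-2 : ℤ) ∈ Set.range g := by rw [hr]; simp
    exact ⟨⟨v, (hp v).1 (by rw [hv]; decide)⟩, by simpa [levels] using hv⟩
  · rintro v hv u hu
    obtain ⟨i, hi⟩ := mem_nbCls.1 hu
    simp only [levels, mem_filter, mem_univ, true_and] at hv ⊢
    have h1 := hbd (flip i v.1)
    rw [← hi]
    rcases hg.cases i v.1 with h | h <;> omega
  · rintro v hv u hu
    obtain ⟨i, hi⟩ := mem_nbCls.1 hu
    simp only [levels, mem_filter, mem_univ, true_and] at hv ⊢
    have h1 := hbd (flip i v.1)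
    rw [← hi]
    rcases hg.cases i v.1 with h | h <;> omega

lemma height_levels {g : (Fin d → Bool) → ℤ}
    (hr : Set.range g = Set.Icc (-2) 2) (hp : ∀ v, Even (g v) ↔ par v = p) :
    height p (levels p g) = g := by
  funext v
  have hbd : -2 ≤ g v ∧ g v ≤ 2 := by
    have : g v ∈ Set.Icc (-2 : ℤ) 2 := hr ▸ Set.mem_range_self v
    exact this
  by_cases hv : par v = p
  · obtain ⟨k, hk⟩ := (hp v).2 hv
    simp only [height, levels, hv, mem_image, if_true, mem_filter, mem_univ, true_and,
      Subtype.exists, exists_and_right, exists_eq_right, exists_prop]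
    split_ifs <;> simp_all; omega
  · have hv' : par v = !p := by revert hv; cases par v <;> cases p <;> simp
    have hodd : ¬ Even (g v) := fun h => hv ((hp v).1 h)
    rw [Int.not_even_iff_odd] at hodd
    obtain ⟨k, hk⟩ := hodd
    simp only [height, levels, hv', mem_image, (ne_not p).symm, if_false, mem_filter, mem_univ,
      true_and, Subtype.exists, exists_and_right, exists_eq_right, exists_prop]
    split_ifs <;> simp_all; omega

/-- The normalised height function encoded by a triple. -/
def toHom (p : Bool) (t : Finset (Cls d (!p)) × Finset (Cls d p) × Finset (Cls d p))
    (v : Fin d → Bool) : ℤ :=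
  height p t v - height p t fun _ => false

lemma height_eq_of_toHom_eq (hd : 1 ≤ d) {q : Bool}
    {t : Finset (Cls d (!p)) × Finset (Cls d p) × Finset (Cls d p)}
    {s : Finset (Cls d (!q)) × Finset (Cls d q) × Finset (Cls d q)}
    (ht : t ∈ triples (nbCls p (!p))) (hs : s ∈ triples (nbCls q (!q)))
    (h : toHom p t = toHom q s) : height p t = height q s := by
  have ht' := range_height hd ht
  have hs' := range_height hd hs
  have hb1 : ∀ v, height p t v ∈ Set.Icc (-2 : ℤ) 2 := fun v => ht' ▸ Set.mem_range_self v
  have hb2 : ∀ v, height q s v ∈ Set.Icc (-2 : ℤ) 2 := fun v => hs' ▸ Set.mem_range_self v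
  have hE : ∀ v, toHom p t v = toHom q s v := fun v => congrFun h v
  simp only [toHom] at hE
  obtain ⟨a, ha⟩ : (-2 : ℤ) ∈ Set.range (height p t) := by rw [ht']; simp
  obtain ⟨b, hb⟩ : (-2 : ℤ) ∈ Set.range (height q s) := by rw [hs']; simp
  funext v
  have h1 := hE a
  have h2 := hE b
  have h3 := hE v
  have h4 := (hb1 b).1
  have h5 := (hb2 a).1
  omega

lemma homFi_five_eq (hd : 1 ≤ d) :
    HomFi d 5 = toHom false '' (triples (nbCls (d := d) false (!false)) : Set _) ∪
      toHom true '' (triples (nbCls (d := d) true (!true)) : Set _) := by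
  apply Set.Subset.antisymm
  · rintro f ⟨⟨hf0, hf⟩, hcard⟩
    have hh : IsHeight f := by
      intro i v
      rw [abs_sub_comm]
      exact hf _ _ ((cubeAdj_iff _ _).2 ⟨i, rfl⟩)
    obtain ⟨m, hm⟩ := hh.exists_range_eq hcard
    have hg : IsHeight fun v => f v - m := by
      intro i v
      simpa using hh i v
    have hr : Set.range (fun v => f v - m) = Set.Icc (-2) 2 := by
      have : Set.range (fun v => f v - m) = (fun x => x - m) '' Set.range f := by
        rw [← Set.range_comp]; rfl
      rw [this, hm, Set.image_sub_const_Icc]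
      congr 1 <;> ring
    obtain ⟨p, hp⟩ := hg.exists_parity
    have hmem : f ∈ toHom p '' (triples (nbCls (d := d) p (!p)) : Set _) := by
      refine ⟨levels p fun v => f v - m, levels_mem_triples hg hr hp, ?_⟩
      funext v
      rw [toHom, height_levels hr hp]
      dsimp only
      rw [hf0]
      ring
    cases p
    · exact Or.inl hmem
    · exact Or.inr hmem
  · have key : ∀ p, toHom p '' (triples (nbCls (d := d) p (!p)) : Set _) ⊆ HomFi d 5 := by
      rintro p _ ⟨t, ht, rfl⟩
      have ht' : t ∈ triples (nbCls (d := d) p (!p)) := ht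
      refine ⟨⟨sub_self _, ?_⟩, ?_⟩
      · intro u v huv
        obtain ⟨i, rfl⟩ := (cubeAdj_iff _ _).1 huv
        rw [abs_sub_comm]
        simpa [toHom] using isHeight_height ht' i u
      · have : Set.range (toHom p t) =
            (fun x => x - height p t fun _ => false) '' Set.range (height p t) := by
          rw [← Set.range_comp]; rfl
        rw [this, Set.ncard_image_of_injective _ (sub_left_injective), range_height hd ht',
          ← coe_Icc, Set.ncard_coe_finset]
        rfl
    exact Set.union_subset (key _) (key _)

lemma ncard_homFi_five (hd : 1 ≤ d) :
    (HomFi d 5).ncard =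
      #(triples (nbCls (d := d) false true)) + #(triples (nbCls (d := d) true false)) := by
  have hinj : ∀ p, Set.InjOn (toHom p)
      (triples (nbCls (d := d) p (!p)) :
        Set (Finset (Cls d (!p)) × Finset (Cls d p) × Finset (Cls d p))) := by
    intro p t ht s hs h
    rw [← levels_height hd (mem_coe.1 ht), ← levels_height hd (mem_coe.1 hs),
      height_eq_of_toHom_eq hd ht hs h]
  rw [homFi_five_eq hd, Set.ncard_union_eq ?_ (Set.toFinite _) (Set.toFinite _),
    (hinj _).ncard_image, (hinj _).ncard_image, Set.ncard_coe_finset,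
    Set.ncard_coe_finset]
  · rfl
  · rw [Set.disjoint_left]
    rintro _ ⟨t, ht, rfl⟩ ⟨s, hs, h⟩
    have h1 := height_eq_of_toHom_eq hd hs ht h
    have h2 := even_height true s fun _ => false
    rw [h1, even_height] at h2
    revert h2
    cases par fun _ : Fin d => false <;> simp

end

end CubeCount

theorem count_homF5 :
    ∃ c > (0:ℝ), ∃ d₀ : ℕ, ∀ d : ℕ, d₀ ≤ d →
      |((HomFi d 5).ncard : ℝ) -
          (2 * Real.exp 1 - 4 * Real.sqrt (Real.exp 1) + 2) * 2 ^ 2 ^ (d - 1)| ≤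
        Real.exp (-c * d) * 2 ^ 2 ^ (d - 1) := by
  obtain ⟨d₀, hd₀, h⟩ := CubeCount.exists_card_triples
  refine ⟨1 / 20, by norm_num, d₀, fun d hd => ?_⟩
  have hd1 : 1 ≤ d := by omega
  have hc := CubeCount.cubeLike_nbCls (p := false) (q := true) hd1 (by simp)
  have h1 := abs_le.1 (h d hd hc)
  have h2 := abs_le.1 (h d hd hc.symm)
  have hs : √(Real.exp 1) ^ 2 = Real.exp 1 := Real.sq_sqrt (Real.exp_pos 1).le
  have he : 2 * Real.exp 1 - 4 * √(Real.exp 1) + 2 = 2 * (√(Real.exp 1) - 1) ^ 2 := by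
    linear_combination -2 * hs
  rw [CubeCount.ncard_homFi_five hd1, he, abs_le]
  push_cast
  constructor <;> linarith [h1.1, h1.2, h2.1, h2.2]
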